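/- arXiv:0809.4909 — 4 statements merged into one kernel-verified Lean document; each statement's English description precedes it below -/
import Mathlib

section
/- Let D = d₁ d₂, let F₁, …, F_D be d₂ × d₁ complex matrices with tr(F_α* F_β) = δ_{αβ}, let λ₁, …, λ_D > 0, and define the linear map φ(a) = Σ_{α=2}^{D} λ_α F_α a F_α* − λ₁ F₁ a F₁* on M_{d₁}(ℂ). Let 1 ≤ k ≤ min(d₁, d₂) and suppose g_k(F₁) < 1. If λ_α ≥ λ₁ g_k(F₁) / (1 − g_k(F₁)) for every α ∈ {2, …, D}, then φ is k-positive. -/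
open scoped ComplexOrder
open Matrix

/-- A linear map `φ : M_{d₁}(ℂ) → M_{d₂}(ℂ)` is `k`-positive if `id_k ⊗ φ` sends
positive semidefinite matrices to positive semidefinite matrices. -/
def kPositive (d₁ d₂ k : ℕ)
    (φ : Matrix (Fin d₁) (Fin d₁) ℂ →ₗ[ℂ] Matrix (Fin d₂) (Fin d₂) ℂ) : Prop :=
  ∀ a : Matrix (Fin k × Fin d₁) (Fin k × Fin d₁) ℂ, a.PosSemidef →
    (Matrix.of fun p q : Fin k × Fin d₂ =>
      φ (Matrix.of fun x y => a (p.1, x) (q.1, y)) p.2 q.2).PosSemidef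

/-- The sum of the `k` largest values of a function on a finite index type. -/
noncomputable def sumKLargest {n : Type*} [Fintype n] (k : ℕ) (f : n → ℝ) : ℝ :=
  sSup {x | ∃ s : Finset n, s.card = k ∧ x = ∑ i ∈ s, f i}

/-- `gk k F` is the sum of the `k` largest eigenvalues of `F * Fᴴ`. -/
noncomputable def gk {d₂ d₁ : ℕ} (k : ℕ) (F : Matrix (Fin d₂) (Fin d₁) ℂ) : ℝ :=
  sumKLargest k (Matrix.isHermitian_mul_conjTranspose_self F).eigenvalues

lemma aux_isometry_factor {n k : ℕ} (Z : Matrix (Fin n) (Fin k) ℂ) :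
    ∃ (m : ℕ) (Q : Matrix (Fin n) (Fin m) ℂ) (R : Matrix (Fin m) (Fin k) ℂ),
      m ≤ k ∧ Qᴴ * Q = 1 ∧ Z = Q * R := by
  let v : Fin k → EuclideanSpace ℂ (Fin n) := fun j => WithLp.toLp 2 (fun y => Z y j)
  let K := Submodule.span ℂ (Set.range v)
  let b := stdOrthonormalBasis ℂ K
  have hv : ∀ j, v j ∈ K := fun j => Submodule.subset_span ⟨j, rfl⟩
  refine ⟨Module.finrank ℂ K, Matrix.of fun y i => (b i : EuclideanSpace ℂ (Fin n)) y,
    Matrix.of fun i j => b.repr ⟨v j, hv j⟩ i, ?_, ?_, ?_⟩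
  · have h := finrank_range_le_card (R := ℂ) v
    rw [Fintype.card_fin] at h
    exact h
  · ext i j
    have h := orthonormal_iff_ite.mp b.orthonormal i j
    rw [Submodule.coe_inner, PiLp.inner_apply] at h
    simp only [Matrix.mul_apply, Matrix.one_apply, conjTranspose_apply, Matrix.of_apply]
    rw [← h]
    refine Finset.sum_congr rfl fun y _ => ?_
    simp [mul_comm]
  · ext y j
    have h := b.sum_repr ⟨v j, hv j⟩
    have h2 := congrArg (fun w : K => (w : EuclideanSpace ℂ (Fin n)) y) h
    simp only [Submodule.coe_sum, Submodule.coe_smul] at h2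
    simp only [Matrix.mul_apply, Matrix.of_apply]
    have h3 : v j y = Z y j := rfl
    rw [← h3, ← h2]
    simp [mul_comm]

lemma aux_le_sumKLargest {n k : ℕ} (hk1 : 1 ≤ k) (hk : k ≤ n) (f w : Fin n → ℝ)
    (hf : ∀ i, 0 ≤ f i) (h0 : ∀ i, 0 ≤ w i) (h1 : ∀ i, w i ≤ 1) (hs : ∑ i, w i ≤ k) :
    ∑ i, f i * w i ≤ sumKLargest k f ∧ 0 ≤ sumKLargest k f := by
  obtain ⟨s, hsm, hmax⟩ := Finset.exists_max_image
    (Finset.powersetCard k (Finset.univ : Finset (Fin n))) (fun s => ∑ i ∈ s, f i)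
    (Finset.powersetCard_nonempty.mpr (by simpa using hk))
  have hcard : s.card = k := (Finset.mem_powersetCard.mp hsm).2
  have hle : ∑ i ∈ s, f i ≤ sumKLargest k f := by
    refine le_csSup ⟨∑ i ∈ s, f i, ?_⟩ ⟨s, hcard, rfl⟩
    rintro x ⟨t, ht, rfl⟩
    exact hmax t (Finset.mem_powersetCard.mpr ⟨Finset.subset_univ _, ht⟩)
  refine ⟨le_trans ?_ hle, le_trans (Finset.sum_nonneg fun i _ => hf i) hle⟩
  have hne : s.Nonempty := Finset.card_pos.mp (by omega)
  obtain ⟨m, hm, hmin⟩ := Finset.exists_min_image s f hne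
  have hout : ∀ j, j ∉ s → f j ≤ f m := by
    intro j hj
    have hj' : j ∉ s.erase m := fun h => hj (Finset.mem_of_mem_erase h)
    have := hmax (insert j (s.erase m)) (Finset.mem_powersetCard.mpr ⟨Finset.subset_univ _, by
      rw [Finset.card_insert_of_notMem hj', Finset.card_erase_of_mem hm]; omega⟩)
    rw [Finset.sum_insert hj'] at this
    have h2 := Finset.add_sum_erase s f hm
    simp only at this
    linarith
  have e1 : ∑ i ∈ s, (f i - f i * w i) ≥ ∑ i ∈ s, (f m - f m * w i) := by
    refine Finset.sum_le_sum fun i hi => ?_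
    nlinarith [hmin i hi, h1 i]
  have e2 : ∑ i ∈ sᶜ, f i * w i ≤ ∑ i ∈ sᶜ, f m * w i := by
    refine Finset.sum_le_sum fun i hi => ?_
    exact mul_le_mul_of_nonneg_right (hout i (by simpa using hi)) (h0 i)
  rw [Finset.sum_sub_distrib, Finset.sum_sub_distrib, ← Finset.mul_sum, Finset.sum_const, hcard,
    nsmul_eq_mul] at e1
  rw [← Finset.mul_sum] at e2
  rw [← Finset.sum_add_sum_compl s] at hs ⊢
  nlinarith [hf m]

lemma aux_iso_diag {n m : ℕ} (W : Matrix (Fin n) (Fin m) ℂ) (hW : Wᴴ * W = 1) :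
    (∀ j, ∑ i, ‖W j i‖ ^ 2 ≤ 1) ∧ ∑ j, ∑ i, ‖W j i‖ ^ 2 = m := by
  constructor
  · intro j
    set P := W * Wᴴ with hP
    have hPP : P * P = P := by
      rw [hP, Matrix.mul_assoc, ← Matrix.mul_assoc Wᴴ, hW, Matrix.one_mul]
    have hPH : Pᴴ = P := by simp [hP]
    have hjj : P j j = ((∑ i, ‖W j i‖ ^ 2 : ℝ) : ℂ) := by
      simp [hP, Matrix.mul_apply, Complex.mul_conj, Complex.normSq_eq_norm_sq]
    have h2 : P j j = ((∑ i, ‖P j i‖ ^ 2 : ℝ) : ℂ) := by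
      conv_lhs => rw [← hPP]
      nth_rewrite 2 [← hPH]
      simp [Matrix.mul_apply, Complex.mul_conj, Complex.normSq_eq_norm_sq]
    have h3 : (∑ i, ‖W j i‖ ^ 2 : ℝ) = ∑ i, ‖P j i‖ ^ 2 := by
      exact_mod_cast hjj.symm.trans h2
    have h4 : ‖P j j‖ ^ 2 ≤ ∑ i, ‖P j i‖ ^ 2 :=
      Finset.single_le_sum (f := fun i => ‖P j i‖ ^ 2) (fun i _ => by positivity)
        (Finset.mem_univ j)
    rw [← h3, hjj, Complex.norm_real, Real.norm_eq_abs, sq_abs] at h4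
    nlinarith
  · have h := congrArg Matrix.trace hW
    have h2 : (Wᴴ * W).trace = ((∑ j, ∑ i, ‖W j i‖ ^ 2 : ℝ) : ℂ) := by
      rw [Finset.sum_comm]
      simp [Matrix.trace, Matrix.mul_apply, Complex.conj_mul']
    rw [h2] at h
    simp only [Matrix.trace_one, Fintype.card_fin] at h
    exact_mod_cast h

lemma aux_diag_trace {n m : ℕ} (f : Fin n → ℝ) (W : Matrix (Fin n) (Fin m) ℂ) :
    (Wᴴ * (diagonal (fun i => ((f i : ℝ) : ℂ)) * W)).trace
      = ((∑ j, f j * ∑ i, ‖W j i‖ ^ 2 : ℝ) : ℂ) := by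
  simp only [Finset.mul_sum]
  rw [Finset.sum_comm]
  simp only [Matrix.trace, Matrix.diag_apply, Matrix.mul_apply (M := Wᴴ), conjTranspose_apply,
    Matrix.diagonal_mul]
  push_cast
  refine Finset.sum_congr rfl fun i _ => Finset.sum_congr rfl fun j _ => ?_
  rw [← Complex.conj_mul']
  simp only [RCLike.star_def]
  ring

lemma aux_kyfan {d₁ d₂ k m : ℕ} (hk1 : 1 ≤ k) (hk : k ≤ d₂) (hm : m ≤ k)
    (F : Matrix (Fin d₂) (Fin d₁) ℂ) (Q : Matrix (Fin d₂) (Fin m) ℂ) (hQ : Qᴴ * Q = 1) :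
    ∑ i, ∑ x, ‖(Qᴴ * F) i x‖ ^ 2 ≤ gk k F ∧ 0 ≤ gk k F := by
  set hA := Matrix.isHermitian_mul_conjTranspose_self F with hAdef
  set U : Matrix (Fin d₂) (Fin d₂) ℂ := (hA.eigenvectorUnitary : Matrix (Fin d₂) (Fin d₂) ℂ)
    with hU
  have hUU : U * Uᴴ = 1 := by
    have := Unitary.coe_mul_star_self hA.eigenvectorUnitary
    simpa [star_eq_conjTranspose] using this
  have hspec : F * Fᴴ = U * diagonal (fun i => ((hA.eigenvalues i : ℝ) : ℂ)) * Uᴴ := by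
    have h := hA.spectral_theorem
    rw [Unitary.conjStarAlgAut_apply] at h
    exact h
  set W := Uᴴ * Q with hWdef
  have hW : Wᴴ * W = 1 := by
    rw [hWdef, conjTranspose_mul, conjTranspose_conjTranspose, Matrix.mul_assoc,
      ← Matrix.mul_assoc U, hUU, Matrix.one_mul, hQ]
  obtain ⟨h1, h2⟩ := aux_iso_diag W hW
  have key : ∑ i, ∑ x, ‖(Qᴴ * F) i x‖ ^ 2 = ∑ j, hA.eigenvalues j * ∑ i, ‖W j i‖ ^ 2 := by
    have e1 : ((Qᴴ * F) * (Qᴴ * F)ᴴ).trace = ((∑ i, ∑ x, ‖(Qᴴ * F) i x‖ ^ 2 : ℝ) : ℂ) := by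
      generalize Qᴴ * F = G
      simp [Matrix.trace, Matrix.mul_apply, Complex.mul_conj']
    have e2 : (Qᴴ * F) * (Qᴴ * F)ᴴ
        = Wᴴ * (diagonal (fun i => ((hA.eigenvalues i : ℝ) : ℂ)) * W) := by
      have h := congrArg (fun T => Qᴴ * (T * Q)) hspec
      rw [conjTranspose_mul, conjTranspose_conjTranspose, Matrix.mul_assoc, ← Matrix.mul_assoc F,
        h, hWdef, conjTranspose_mul, conjTranspose_conjTranspose]
      simp only [Matrix.mul_assoc]
    have e3 : (Wᴴ * (diagonal (fun i => ((hA.eigenvalues i : ℝ) : ℂ)) * W)).trace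
        = ((∑ j, hA.eigenvalues j * ∑ i, ‖W j i‖ ^ 2 : ℝ) : ℂ) := by
      exact aux_diag_trace _ _
    rw [e2, e3] at e1
    exact_mod_cast e1.symm
  rw [key]
  refine aux_le_sumKLargest hk1 hk _ _
    (fun i => (posSemidef_self_mul_conjTranspose F).eigenvalues_nonneg i)
    (fun j => Finset.sum_nonneg fun i _ => by positivity) h1 ?_
  rw [h2]
  exact_mod_cast hm

lemma aux_cs {ι : Type*} [Fintype ι] (f g : ι → ℂ) :
    ‖∑ i, star (f i) * g i‖ ^ 2 ≤ (∑ i, ‖f i‖ ^ 2) * ∑ i, ‖g i‖ ^ 2 := by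
  have h : ‖∑ i, star (f i) * g i‖ ≤ ∑ i, ‖f i‖ * ‖g i‖ := by
    refine (norm_sum_le _ _).trans (le_of_eq ?_)
    simp
  calc _ ≤ (∑ i, ‖f i‖ * ‖g i‖) ^ 2 := by gcongr
    _ ≤ _ := Finset.sum_mul_sq_le_sq_mul_sq _ _ _

lemma aux_rank_bound {d₁ d₂ k : ℕ} (hk1 : 1 ≤ k) (hk : k ≤ d₂)
    (F : Matrix (Fin d₂) (Fin d₁) ℂ) (Z : Matrix (Fin d₂) (Fin k) ℂ)
    (B : Matrix (Fin k) (Fin d₁) ℂ) :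
    ‖(Fᴴ * (Z * B)).trace‖ ^ 2 ≤ gk k F * ∑ y, ∑ x, ‖(Z * B) y x‖ ^ 2 ∧ 0 ≤ gk k F := by
  obtain ⟨m, Q, R, hm, hQ, rfl⟩ := aux_isometry_factor Z
  obtain ⟨h1, h0⟩ := aux_kyfan hk1 hk hm F Q hQ
  refine ⟨?_, h0⟩
  set Y := R * B with hY
  have e0 : Q * R * B = Q * Y := Matrix.mul_assoc _ _ _
  rw [e0]
  have e1 : Fᴴ * (Q * Y) = (Qᴴ * F)ᴴ * Y := by
    rw [conjTranspose_mul, conjTranspose_conjTranspose, Matrix.mul_assoc]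
  have fro : ∀ {n : ℕ} (X : Matrix (Fin n) (Fin d₁) ℂ),
      (Xᴴ * X).trace = ((∑ y, ∑ x, ‖X y x‖ ^ 2 : ℝ) : ℂ) := by
    intro n X
    rw [Finset.sum_comm]
    simp [Matrix.trace, Matrix.mul_apply, Complex.conj_mul']
  have e2 : ∑ y, ∑ x, ‖(Q * Y) y x‖ ^ 2 = ∑ y, ∑ x, ‖Y y x‖ ^ 2 := by
    have h := fro (Q * Y)
    have h' : (Q * Y)ᴴ * (Q * Y) = Yᴴ * Y := by
      rw [conjTranspose_mul, Matrix.mul_assoc, ← Matrix.mul_assoc Qᴴ, hQ, Matrix.one_mul]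
    rw [h', fro Y] at h
    exact_mod_cast h.symm
  rw [e1, e2]
  have e3 : ((Qᴴ * F)ᴴ * Y).trace
      = ∑ p : Fin m × Fin d₁, star ((Qᴴ * F) p.1 p.2) * Y p.1 p.2 := by
    generalize Qᴴ * F = G
    rw [Fintype.sum_prod_type, Finset.sum_comm]
    simp [Matrix.trace, Matrix.mul_apply]
  rw [e3]
  refine (aux_cs (fun p : Fin m × Fin d₁ => (Qᴴ * F) p.1 p.2) (fun p => Y p.1 p.2)).trans ?_
  rw [Fintype.sum_prod_type, Fintype.sum_prod_type]
  exact mul_le_mul_of_nonneg_right h1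
    (Finset.sum_nonneg fun i _ => Finset.sum_nonneg fun j _ => by positivity)

lemma aux_parseval {d₁ d₂ : ℕ} (F : Fin (d₁ * d₂) → Matrix (Fin d₂) (Fin d₁) ℂ)
    (hF : ∀ α β, ((F α)ᴴ * F β).trace = if α = β then 1 else 0)
    (X : Matrix (Fin d₂) (Fin d₁) ℂ) :
    ∑ α, ‖((F α)ᴴ * X).trace‖ ^ 2 = ∑ y, ∑ x, ‖X y x‖ ^ 2 := by
  let G : Matrix (Fin (d₁ * d₂)) (Fin d₂ × Fin d₁) ℂ :=
    Matrix.of fun α p => star (F α p.1 p.2)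
  have htr : ∀ (A X : Matrix (Fin d₂) (Fin d₁) ℂ), (Aᴴ * X).trace
      = ∑ p : Fin d₂ × Fin d₁, star (A p.1 p.2) * X p.1 p.2 := by
    intro A X
    rw [Fintype.sum_prod_type, Finset.sum_comm]
    simp [Matrix.trace, Matrix.mul_apply]
  have h1 : G * Gᴴ = 1 := by
    ext α β
    have h := hF α β
    rw [htr] at h
    rw [Matrix.one_apply, ← h]
    simp [G, Matrix.mul_apply]
  have e : Fin (d₁ * d₂) ≃ Fin d₂ × Fin d₁ :=
    Fintype.equivOfCardEq (by simp [mul_comm])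
  have h2 : Gᴴ * G = 1 := (Matrix.mul_eq_one_comm_of_equiv e).mp h1
  let v : Fin d₂ × Fin d₁ → ℂ := fun p => X p.1 p.2
  have h3 : ∀ α, (G *ᵥ v) α = ((F α)ᴴ * X).trace := by
    intro α
    rw [htr]
    simp [G, v, Matrix.mulVec, dotProduct]
  have h4 : star (G *ᵥ v) ⬝ᵥ (G *ᵥ v) = star v ⬝ᵥ v := by
    rw [Matrix.star_mulVec, Matrix.dotProduct_mulVec, Matrix.vecMul_vecMul, h2, Matrix.vecMul_one]
  have h5 : ∀ {ι : Type} [Fintype ι] (w : ι → ℂ), star w ⬝ᵥ w = ((∑ i, ‖w i‖ ^ 2 : ℝ) : ℂ) := by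
    intro ι _ w
    simp [dotProduct, Complex.conj_mul']
  rw [h5, h5] at h4
  have h6 : ∑ i, ‖(G *ᵥ v) i‖ ^ 2 = ∑ i, ‖v i‖ ^ 2 := by exact_mod_cast h4
  simp only [h3] at h6
  rw [h6, Fintype.sum_prod_type]

/-- The block form `(1 ⊗ F) a (1 ⊗ F)ᴴ`. -/
lemma aux_block {d₁ d₂ k : ℕ} (F : Matrix (Fin d₂) (Fin d₁) ℂ)
    (B : Matrix (Fin k × Fin d₁) (Fin k × Fin d₁) ℂ) (z : Fin k × Fin d₂ → ℂ) :
    let M : Matrix (Fin k × Fin d₂) (Fin k × Fin d₂) ℂ := Matrix.of fun p q =>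
      (F * (Matrix.of fun x y => (Bᴴ * B) (p.1, x) (q.1, y)) * Fᴴ) p.2 q.2
    M.IsHermitian ∧ star z ⬝ᵥ (M *ᵥ z) = ((∑ r, ‖(Fᴴ * ((Matrix.of fun y i => z (i, y)) *
      (Matrix.of fun i x => B r (i, x)))).trace‖ ^ 2 : ℝ) : ℂ) := by
  intro M
  let N : Matrix (Fin k × Fin d₁) (Fin k × Fin d₂) ℂ :=
    Matrix.of fun s p => ∑ x, B s (p.1, x) * star (F p.2 x)
  have hM : M = Nᴴ * N := by
    ext p q
    simp only [M, N, Matrix.of_apply, Matrix.mul_apply, conjTranspose_apply, star_sum, star_mul',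
      star_star, Finset.sum_mul, Finset.mul_sum]
    rw [Finset.sum_comm]
    conv_lhs => enter [2, x]; rw [Finset.sum_comm]
    rw [Finset.sum_comm]
    refine Finset.sum_congr rfl fun s _ => ?_
    rw [Finset.sum_comm]
    refine Finset.sum_congr rfl fun x _ => Finset.sum_congr rfl fun y _ => ?_
    ring
  refine ⟨hM ▸ Matrix.isHermitian_conjTranspose_mul_self N, ?_⟩
  rw [hM, ← Matrix.mulVec_mulVec, Matrix.dotProduct_mulVec, ← Matrix.star_mulVec]
  have h3 : ∀ r, (N *ᵥ z) r = (Fᴴ * ((Matrix.of fun y i => z (i, y)) *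
      (Matrix.of fun i x => B r (i, x)))).trace := by
    intro r
    simp only [N, Matrix.mulVec, dotProduct, Matrix.trace, Matrix.diag_apply, Matrix.mul_apply,
      Matrix.of_apply, conjTranspose_apply, Finset.sum_mul, Finset.mul_sum,
      Fintype.sum_prod_type]
    conv_lhs => enter [2, i]; rw [Finset.sum_comm]
    rw [Finset.sum_comm]
    refine Finset.sum_congr rfl fun x _ => ?_
    rw [Finset.sum_comm]
    refine Finset.sum_congr rfl fun y _ => Finset.sum_congr rfl fun i _ => ?_
    ring
  simp only [← h3]
  simp [dotProduct, Complex.conj_mul']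

/-- Spectral condition for `k`-positivity of `φ(a) = ∑_{α≥2} λ_α F_α a F_αᴴ − λ₁ F₁ a F₁ᴴ`. -/
theorem kPositive_of_spectral_condition (d₁ d₂ k : ℕ) (hk1 : 1 ≤ k) (hk2 : k ≤ min d₁ d₂)
    (F : Fin (d₁ * d₂) → Matrix (Fin d₂) (Fin d₁) ℂ)
    (hF : ∀ α β, ((F α)ᴴ * F β).trace = if α = β then 1 else 0)
    (lam : Fin (d₁ * d₂) → ℝ) (hlam : ∀ α, 0 < lam α)
    (α₁ : Fin (d₁ * d₂)) (hα₁ : (α₁ : ℕ) = 0)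
    (φ : Matrix (Fin d₁) (Fin d₁) ℂ →ₗ[ℂ] Matrix (Fin d₂) (Fin d₂) ℂ)
    (hφ : ∀ a, φ a = (∑ α ∈ Finset.univ.erase α₁, (lam α : ℂ) • (F α * a * (F α)ᴴ))
        - (lam α₁ : ℂ) • (F α₁ * a * (F α₁)ᴴ))
    (hg : gk k (F α₁) < 1)
    (hcond : ∀ α ∈ Finset.univ.erase α₁,
      lam α₁ * gk k (F α₁) / (1 - gk k (F α₁)) ≤ lam α) :
    kPositive d₁ d₂ k φ := by
  intro a ha
  have hkd : k ≤ d₂ := hk2.trans (min_le_right _ _)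
  obtain ⟨B, hB⟩ : ∃ B : Matrix (Fin k × Fin d₁) (Fin k × Fin d₁) ℂ, a = Bᴴ * B := by
    open scoped MatrixOrder in
    exact CStarAlgebra.nonneg_iff_eq_star_mul_self.mp ha.nonneg
  subst hB
  let M : Fin (d₁ * d₂) → Matrix (Fin k × Fin d₂) (Fin k × Fin d₂) ℂ := fun α =>
    Matrix.of fun p q =>
      (F α * (Matrix.of fun x y => (Bᴴ * B) (p.1, x) (q.1, y)) * (F α)ᴴ) p.2 q.2
  have hM : (Matrix.of fun p q : Fin k × Fin d₂ =>
      φ (Matrix.of fun x y => (Bᴴ * B) (p.1, x) (q.1, y)) p.2 q.2)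
      = (∑ α ∈ Finset.univ.erase α₁, (lam α : ℂ) • M α) - (lam α₁ : ℂ) • M α₁ := by
    ext p q
    simp only [Matrix.of_apply, hφ, Matrix.sub_apply, Matrix.sum_apply, Matrix.smul_apply, M]
  rw [hM]
  have hsm : ∀ α, ((lam α : ℂ) • M α).IsHermitian := by
    intro α
    have h := (aux_block (F α) B 0).1
    unfold Matrix.IsHermitian at h ⊢
    rw [conjTranspose_smul]
    simp only [RCLike.star_def, Complex.conj_ofReal]
    exact congrArg _ h
  refine Matrix.PosSemidef.of_dotProduct_mulVec_nonneg ?_ fun z => ?_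
  · refine Matrix.IsHermitian.sub ?_ (hsm α₁)
    unfold Matrix.IsHermitian
    rw [conjTranspose_sum]
    exact Finset.sum_congr rfl fun α _ => hsm α
  · let X : Fin k × Fin d₁ → Matrix (Fin d₂) (Fin d₁) ℂ := fun r =>
      (Matrix.of fun y i => z (i, y)) * (Matrix.of fun i x => B r (i, x))
    have hq : ∀ α, star z ⬝ᵥ (M α *ᵥ z) = ((∑ r, ‖((F α)ᴴ * X r).trace‖ ^ 2 : ℝ) : ℂ) :=
      fun α => (aux_block (F α) B z).2
    have hval : star z ⬝ᵥ (((∑ α ∈ Finset.univ.erase α₁, (lam α : ℂ) • M α)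
        - (lam α₁ : ℂ) • M α₁) *ᵥ z) = ((∑ r, ((∑ α ∈ Finset.univ.erase α₁,
          lam α * ‖((F α)ᴴ * X r).trace‖ ^ 2) - lam α₁ * ‖((F α₁)ᴴ * X r).trace‖ ^ 2) : ℝ) : ℂ) := by
      rw [Matrix.sub_mulVec, Matrix.sum_mulVec, dotProduct_sub, dotProduct_sum]
      simp only [Matrix.smul_mulVec, dotProduct_smul, hq, smul_eq_mul]
      rw [Finset.sum_sub_distrib, Finset.sum_comm]
      push_cast
      simp only [Finset.mul_sum]
    rw [hval]
    refine Complex.zero_le_real.mpr (Finset.sum_nonneg fun r _ => ?_)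
    obtain ⟨hb, h0⟩ := aux_rank_bound hk1 hkd (F α₁) (Matrix.of fun y i => z (i, y))
      (Matrix.of fun i x => B r (i, x))
    have hp := aux_parseval F hF (X r)
    rw [← hp, ← Finset.add_sum_erase _ _ (Finset.mem_univ α₁)] at hb
    change ‖((F α₁)ᴴ * X r).trace‖ ^ 2 ≤ gk k (F α₁) * (‖((F α₁)ᴴ * X r).trace‖ ^ 2 + _) at hb
    set g := gk k (F α₁)
    set t := ‖((F α₁)ᴴ * X r).trace‖ ^ 2
    have hs : (lam α₁ * g / (1 - g)) * ∑ α ∈ Finset.univ.erase α₁, ‖((F α)ᴴ * X r).trace‖ ^ 2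
        ≤ ∑ α ∈ Finset.univ.erase α₁, lam α * ‖((F α)ᴴ * X r).trace‖ ^ 2 := by
      rw [Finset.mul_sum]
      exact Finset.sum_le_sum fun α hα =>
        mul_le_mul_of_nonneg_right (hcond α hα) (by positivity)
    set S := ∑ α ∈ Finset.univ.erase α₁, ‖((F α)ᴴ * X r).trace‖ ^ 2
    have hg' : 0 < 1 - g := by linarith
    have h5 : lam α₁ * t ≤ (lam α₁ * g / (1 - g)) * S := by
      rw [div_mul_eq_mul_div, le_div_iff₀ hg']
      have h6 : t * (1 - g) ≤ g * S := by linarith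
      nlinarith [hlam α₁]
    linarith
end

section
/- Let D = d₁ d₂, let F₁, …, F_D be d₂ × d₁ complex matrices with tr(F_α* F_β) = δ_{αβ}, let λ₁, …, λ_D > 0, let 1 ≤ m < D, and define the linear map φ(a) = Σ_{α=m+1}^{D} λ_α F_α a F_α* − Σ_{α=1}^{m} λ_α F_α a F_α* on M_{d₁}(ℂ). Let 1 ≤ k ≤ min(d₁, d₂) and suppose Σ_{α=1}^{m} g_k(F_α) < 1. If λ_α ≥ (Σ_{β=1}^{m} λ_β g_k(F_β)) / (1 − Σ_{β=1}^{m} g_k(F_β)) for every α ∈ {m+1, …, D}, then φ is k-positive. -/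
open scoped ComplexOrder
open Matrix

lemma kf_comb {n : Type*} [Fintype n] (k : ℕ) (hk : 1 ≤ k) (hkn : k ≤ Fintype.card n)
    (f t : n → ℝ) (hf : ∀ i, 0 ≤ f i) (ht0 : ∀ i, 0 ≤ t i) (ht1 : ∀ i, t i ≤ 1)
    (hts : ∑ i, t i ≤ k) : ∃ s : Finset n, s.card = k ∧ ∑ i, f i * t i ≤ ∑ i ∈ s, f i := by
  classical
  have hne : (Finset.powersetCard k (Finset.univ : Finset n)).Nonempty := by
    rw [Finset.powersetCard_nonempty]; simpa using hkn
  obtain ⟨s, hs, hmax⟩ := Finset.exists_max_image _ (fun s => ∑ i ∈ s, f i) hne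
  have hsc : s.card = k := (Finset.mem_powersetCard.1 hs).2
  refine ⟨s, hsc, ?_⟩
  have hsne : s.Nonempty := Finset.card_pos.1 (by omega)
  obtain ⟨i0, hi0, hmin⟩ := Finset.exists_min_image s f hsne
  have hoff : ∀ j, j ∉ s → f j ≤ f i0 := by
    intro j hj
    have hj' : j ∉ s.erase i0 := fun h => hj (Finset.mem_of_mem_erase h)
    have h1 := hmax (insert j (s.erase i0)) (by
      rw [Finset.mem_powersetCard]
      refine ⟨Finset.subset_univ _, ?_⟩
      rw [Finset.card_insert_of_notMem hj', Finset.card_erase_of_mem hi0]; omega)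
    rw [Finset.sum_insert hj', ← Finset.add_sum_erase s f hi0] at h1
    linarith
  have key : ∀ i, f i * t i - (if i ∈ s then f i else 0) ≤ f i0 * (t i - if i ∈ s then 1 else 0) := by
    intro i
    by_cases h : i ∈ s
    · simp only [h, if_true]; nlinarith [hmin i h, ht1 i]
    · simp only [h, if_false]; nlinarith [hoff i h, ht0 i]
  have h2 := Finset.sum_le_sum (fun i (_ : i ∈ Finset.univ) => key i)
  rw [← Finset.mul_sum, Finset.sum_sub_distrib, Finset.sum_sub_distrib] at h2
  simp only [Finset.sum_ite_mem, Finset.univ_inter, Finset.sum_const, hsc, nsmul_eq_mul, mul_one] at h2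
  nlinarith [hf i0]

lemma le_gk {d₂ d₁ : ℕ} (k : ℕ) (F : Matrix (Fin d₂) (Fin d₁) ℂ) (s : Finset (Fin d₂))
    (hs : s.card = k) :
    ∑ i ∈ s, (Matrix.isHermitian_mul_conjTranspose_self F).eigenvalues i ≤ gk k F := by
  unfold gk sumKLargest
  apply le_csSup
  · apply Set.Finite.bddAbove
    apply Set.Finite.subset (Set.finite_range (fun s : Finset (Fin d₂) =>
      ∑ i ∈ s, (Matrix.isHermitian_mul_conjTranspose_self F).eigenvalues i))
    rintro x ⟨s, -, rfl⟩
    exact ⟨s, rfl⟩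
  · exact ⟨s, hs, rfl⟩

lemma quad_eig {n : ℕ} (A : Matrix (Fin n) (Fin n) ℂ) (hA : A.IsHermitian)
    (e : EuclideanSpace ℂ (Fin n)) :
    inner ℂ e (Matrix.toEuclideanLin A e) =
      ((∑ j, hA.eigenvalues j * ‖inner ℂ (hA.eigenvectorBasis j) e‖ ^ 2 : ℝ) : ℂ) := by
  rw [← hA.eigenvectorBasis.sum_inner_mul_inner]
  push_cast
  refine Finset.sum_congr rfl fun j _ => ?_
  have hsym := Matrix.isSymmetric_toEuclideanLin_iff.2 hA
  rw [← hsym (hA.eigenvectorBasis j) e]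
  have : Matrix.toEuclideanLin A (hA.eigenvectorBasis j)
      = (hA.eigenvalues j : ℂ) • hA.eigenvectorBasis j := by
    ext i
    have := congrFun (hA.mulVec_eigenvectorBasis j) i
    simpa [Matrix.toLpLin_apply] using this
  rw [this, inner_smul_left, Complex.conj_ofReal, ← inner_conj_symm e,
    mul_left_comm, ← Complex.normSq_eq_conj_mul_self, Complex.normSq_eq_norm_sq]
  simp

lemma quad_cols {d₂ d₁ : ℕ} (F : Matrix (Fin d₂) (Fin d₁) ℂ) (e : EuclideanSpace ℂ (Fin d₂)) :
    inner ℂ e (Matrix.toEuclideanLin (F * Fᴴ) e) =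
      ((∑ x, ‖inner ℂ e (WithLp.toLp 2 (fun p => F p x) : EuclideanSpace ℂ (Fin d₂))‖ ^ 2 : ℝ) : ℂ) := by
  have h1 : ∀ x, inner ℂ e (WithLp.toLp 2 (fun p => F p x) : EuclideanSpace ℂ (Fin d₂))
      = star ((Fᴴ *ᵥ e.ofLp) x) := by
    intro x
    simp [PiLp.inner_apply, Matrix.mulVec, dotProduct]
  have h2 : inner ℂ e (Matrix.toEuclideanLin (F * Fᴴ) e)
      = star (Fᴴ *ᵥ e.ofLp) ⬝ᵥ (Fᴴ *ᵥ e.ofLp) := by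
    rw [Matrix.star_mulVec, Matrix.conjTranspose_conjTranspose, ← Matrix.dotProduct_mulVec,
      Matrix.mulVec_mulVec, Matrix.toLpLin_apply, EuclideanSpace.inner_eq_star_dotProduct]
    simp [dotProduct_comm]
  rw [h2]
  push_cast
  simp only [dotProduct]
  refine Finset.sum_congr rfl fun x _ => ?_
  rw [h1, norm_star, Pi.star_apply, ← starRingEnd_apply, ← Complex.normSq_eq_conj_mul_self,
    Complex.normSq_eq_norm_sq]
  simp

lemma kyfan {d₂ d₁ : ℕ} (k r : ℕ) (hk : 1 ≤ k) (hk2 : k ≤ d₂) (hr : r ≤ k)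
    (F : Matrix (Fin d₂) (Fin d₁) ℂ) (e : Fin r → EuclideanSpace ℂ (Fin d₂))
    (he : Orthonormal ℂ e) :
    ∑ l, ∑ x, ‖inner ℂ (e l) (WithLp.toLp 2 (fun p => F p x) : EuclideanSpace ℂ (Fin d₂))‖ ^ 2
      ≤ gk k F := by
  have hA := Matrix.isHermitian_mul_conjTranspose_self F
  have h0 : ∀ l, ∑ x, ‖inner ℂ (e l) (WithLp.toLp 2 (fun p => F p x) : EuclideanSpace ℂ (Fin d₂))‖ ^ 2
      = ∑ j, hA.eigenvalues j * ‖inner ℂ (hA.eigenvectorBasis j) (e l)‖ ^ 2 := by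
    intro l
    have := (quad_cols F (e l)).symm.trans (quad_eig _ hA (e l))
    exact_mod_cast this
  simp only [h0]
  rw [Finset.sum_comm]
  simp only [← Finset.mul_sum]
  obtain ⟨s, hs, hle⟩ := kf_comb k hk (by simpa using hk2) hA.eigenvalues
    (fun j => ∑ l, ‖inner ℂ (hA.eigenvectorBasis j) (e l)‖ ^ 2)
    (fun i => (Matrix.posSemidef_self_mul_conjTranspose F).eigenvalues_nonneg i)
    (fun i => Finset.sum_nonneg fun _ _ => by positivity)
    (fun i => by
      have := he.sum_inner_products_le (s := Finset.univ) (hA.eigenvectorBasis i)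
      simp only [norm_inner_symm] at this ⊢
      have h1 := hA.eigenvectorBasis.orthonormal.1 i
      rw [h1] at this
      simpa [norm_inner_symm] using this)
    (by
      rw [Finset.sum_comm]
      simp only [OrthonormalBasis.sum_sq_norm_inner_right, he.1]
      simpa using hr)
  exact hle.trans (le_gk k F s hs)

lemma key_bound {d₂ d₁ : ℕ} (k : ℕ) (hk : 1 ≤ k) (hk2 : k ≤ d₂)
    (F : Matrix (Fin d₂) (Fin d₁) ℂ) (w : Fin k → Fin d₂ → ℂ) (v : Fin k → Fin d₁ → ℂ)
    (G : Matrix (Fin d₂) (Fin d₁) ℂ) (hG : ∀ p x, G p x = ∑ i, v i x * w i p) :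
    ‖∑ x, ∑ p, star (G p x) * F p x‖ ^ 2 ≤ gk k F * ∑ x, ∑ p, ‖G p x‖ ^ 2 := by
  let W : Fin k → EuclideanSpace ℂ (Fin d₂) := fun i => WithLp.toLp 2 (w i)
  let g : Fin d₁ → EuclideanSpace ℂ (Fin d₂) := fun x => WithLp.toLp 2 (fun p => G p x)
  let f : Fin d₁ → EuclideanSpace ℂ (Fin d₂) := fun x => WithLp.toLp 2 (fun p => F p x)
  let U : Submodule ℂ (EuclideanSpace ℂ (Fin d₂)) := Submodule.span ℂ (Set.range W)
  have hr : Module.finrank ℂ U ≤ k := by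
    simpa [Set.finrank] using finrank_range_le_card (R := ℂ) W
  have hgU : ∀ x, g x ∈ U := by
    intro x
    have : g x = ∑ i, v i x • W i := by
      ext p; simp [g, W, hG]
    rw [this]
    exact Submodule.sum_mem _ fun i _ => Submodule.smul_mem _ _ (Submodule.subset_span ⟨i, rfl⟩)
  let b := stdOrthonormalBasis ℂ U
  let e : Fin (Module.finrank ℂ U) → EuclideanSpace ℂ (Fin d₂) := fun l => (b l : EuclideanSpace ℂ (Fin d₂))
  have he : Orthonormal ℂ e := b.orthonormal.comp_linearIsometry U.subtypeₗᵢ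
  have hexp : ∀ x, g x = ∑ l, inner ℂ (e l) (g x) • e l := by
    intro x
    have := congrArg (Subtype.val) (b.sum_repr' ⟨g x, hgU x⟩)
    simpa [e] using this.symm
  have hky := kyfan k _ hk hk2 hr F e he
  have h1 : ∑ x, ∑ p, star (G p x) * F p x = ∑ q : Fin d₁ × Fin (Module.finrank ℂ U),
      star (inner ℂ (e q.2) (g q.1)) * inner ℂ (e q.2) (f q.1) := by
    rw [Fintype.sum_prod_type]
    refine Finset.sum_congr rfl fun x _ => ?_
    have : ∑ p, star (G p x) * F p x = inner ℂ (g x) (f x) := by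
      simp [PiLp.inner_apply, g, f, mul_comm]
    rw [this]
    conv_lhs => rw [hexp x]
    rw [sum_inner]
    simp [inner_smul_left]
  have h2 : ∑ q : Fin d₁ × Fin (Module.finrank ℂ U), ‖inner ℂ (e q.2) (g q.1)‖ ^ 2
      ≤ ∑ x, ∑ p, ‖G p x‖ ^ 2 := by
    rw [Fintype.sum_prod_type]
    refine Finset.sum_le_sum fun x _ => ?_
    refine (he.sum_inner_products_le (g x)).trans ?_
    rw [EuclideanSpace.norm_sq_eq]
  have h3 : ∑ q : Fin d₁ × Fin (Module.finrank ℂ U), ‖inner ℂ (e q.2) (f q.1)‖ ^ 2 ≤ gk k F := by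
    rw [Fintype.sum_prod_type, Finset.sum_comm]
    exact hky
  rw [h1]
  have hcs : ‖∑ q : Fin d₁ × Fin (Module.finrank ℂ U),
      star (inner ℂ (e q.2) (g q.1)) * inner ℂ (e q.2) (f q.1)‖ ^ 2 ≤
      (∑ q : Fin d₁ × Fin (Module.finrank ℂ U), ‖inner ℂ (e q.2) (g q.1)‖ ^ 2) *
      ∑ q : Fin d₁ × Fin (Module.finrank ℂ U), ‖inner ℂ (e q.2) (f q.1)‖ ^ 2 := by
    refine le_trans ?_ (Finset.sum_mul_sq_le_sq_mul_sq _ _ _)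
    gcongr
    refine (norm_sum_le _ _).trans (le_of_eq ?_)
    simp only [norm_mul, norm_star]
  refine hcs.trans ?_
  rw [mul_comm]
  have : 0 ≤ ∑ q : Fin d₁ × Fin (Module.finrank ℂ U), ‖inner ℂ (e q.2) (f q.1)‖ ^ 2 :=
    Finset.sum_nonneg fun _ _ => by positivity
  exact mul_le_mul h3 h2 (Finset.sum_nonneg fun _ _ => by positivity) (this.trans h3)

lemma parseval {d₁ d₂ : ℕ} (hpos : 0 < d₁ * d₂)
    (F : Fin (d₁ * d₂) → Matrix (Fin d₂) (Fin d₁) ℂ)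
    (hF : ∀ α β, ((F α)ᴴ * F β).trace = if α = β then 1 else 0)
    (G : Matrix (Fin d₂) (Fin d₁) ℂ) :
    ∑ α, ‖∑ x, ∑ p, star (G p x) * F α p x‖ ^ 2 = ∑ x, ∑ p, ‖G p x‖ ^ 2 := by
  have : Nonempty (Fin (d₁ * d₂)) := ⟨⟨0, hpos⟩⟩
  let L : Matrix (Fin d₂) (Fin d₁) ℂ → EuclideanSpace ℂ (Fin d₁ × Fin d₂) :=
    fun M => WithLp.toLp 2 (fun q => M q.2 q.1)
  have hin : ∀ M N, inner ℂ (L M) (L N) = ∑ x, ∑ p, star (M p x) * N p x := by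
    intro M N
    simp [L, PiLp.inner_apply, Fintype.sum_prod_type, mul_comm]
  have hon : Orthonormal ℂ (fun α => L (F α)) := by
    rw [orthonormal_iff_ite]
    intro α β
    rw [hin, ← hF α β]
    simp [Matrix.trace, Matrix.mul_apply]
  let b := basisOfOrthonormalOfCardEqFinrank hon (by simp)
  have hb : ⇑b = fun α => L (F α) := coe_basisOfOrthonormalOfCardEqFinrank hon (by simp)
  let B := b.toOrthonormalBasis (by rw [hb]; exact hon)
  have hB : ∀ α, B α = L (F α) := fun α => by simp [B, hb]
  have := B.sum_sq_norm_inner_right (L G)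
  rw [EuclideanSpace.norm_sq_eq, Fintype.sum_prod_type] at this
  simp only [hB] at this
  rw [← show _ = ∑ x, ∑ p, ‖G p x‖ ^ 2 from rfl] at this
  rw [← this]
  refine Finset.sum_congr rfl fun α _ => ?_
  rw [← hin, norm_inner_symm]

lemma scalar_ineq {ι : Type*} [Fintype ι] (S T : Finset ι)
    (hST : ∀ f : ι → ℝ, ∑ i, f i = ∑ i ∈ T, f i + ∑ i ∈ S, f i)
    (lam g z : ι → ℝ) (N : ℝ) (hlam : ∀ i, 0 < lam i) (hz : ∀ i, 0 ≤ z i)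
    (hzg : ∀ i, z i ≤ g i * N) (hg0 : ∀ i, 0 ≤ g i) (hsum : ∑ i, z i = N)
    (hg : ∑ i ∈ S, g i < 1)
    (hcond : ∀ i ∈ T, (∑ j ∈ S, lam j * g j) / (1 - ∑ j ∈ S, g j) ≤ lam i) :
    ∑ i ∈ S, lam i * z i ≤ ∑ i ∈ T, lam i * z i := by
  set c := (∑ j ∈ S, lam j * g j) / (1 - ∑ j ∈ S, g j) with hc
  have hpos : 0 < 1 - ∑ j ∈ S, g j := by linarith
  have hc0 : 0 ≤ c := div_nonneg
    (Finset.sum_nonneg fun i _ => mul_nonneg (hlam i).le (hg0 i)) hpos.le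
  have hceq : c * (1 - ∑ j ∈ S, g j) = ∑ j ∈ S, lam j * g j := div_mul_cancel₀ _ hpos.ne'
  have h1 : c * ∑ i ∈ T, z i ≤ ∑ i ∈ T, lam i * z i := by
    rw [Finset.mul_sum]
    exact Finset.sum_le_sum fun i hi => mul_le_mul_of_nonneg_right (hcond i hi) (hz i)
  have h2 : ∑ i ∈ S, lam i * z i ≤ (∑ i ∈ S, lam i * g i) * N := by
    rw [Finset.sum_mul]
    refine Finset.sum_le_sum fun i hi => ?_
    rw [mul_assoc]
    exact mul_le_mul_of_nonneg_left (hzg i) (hlam i).le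
  have h3 : ∑ i ∈ S, z i ≤ (∑ i ∈ S, g i) * N := by
    rw [Finset.sum_mul]
    exact Finset.sum_le_sum fun i hi => hzg i
  have h4 := hST z
  rw [hsum] at h4
  have h5 : ∑ i ∈ T, z i = N - ∑ i ∈ S, z i := by linarith
  rw [h5] at h1
  have h6 := mul_le_mul_of_nonneg_left h3 hc0
  rw [← hceq] at h2
  linarith

lemma gk_nonneg {d₂ d₁ : ℕ} (k : ℕ) (hk2 : k ≤ d₂) (F : Matrix (Fin d₂) (Fin d₁) ℂ) :
    0 ≤ gk k F := by
  obtain ⟨s, -, hs⟩ := Finset.exists_subset_card_eq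
    (s := (Finset.univ : Finset (Fin d₂))) (n := k) (by simpa using hk2)
  exact (Finset.sum_nonneg fun i _ =>
    (Matrix.posSemidef_self_mul_conjTranspose F).eigenvalues_nonneg i).trans (le_gk k F s hs)

lemma quadKK {n r : Type*} [Fintype n] [Fintype r] (K : Matrix n r ℂ) (w : n → ℂ) :
    star w ⬝ᵥ ((K * Kᴴ) *ᵥ w) = ((∑ j, ‖(Kᴴ *ᵥ w) j‖ ^ 2 : ℝ) : ℂ) := by
  rw [← Matrix.mulVec_mulVec, Matrix.dotProduct_mulVec]
  have : star w ᵥ* K = star (Kᴴ *ᵥ w) := by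
    rw [Matrix.star_mulVec, Matrix.conjTranspose_conjTranspose]
  rw [this]
  push_cast
  simp only [dotProduct]
  refine Finset.sum_congr rfl fun x _ => ?_
  rw [Pi.star_apply, ← starRingEnd_apply, ← Complex.normSq_eq_conj_mul_self,
    Complex.normSq_eq_norm_sq]
  simp

/-- Spectral condition for `k`-positivity of
`φ(a) = ∑_{α>m} λ_α F_α a F_αᴴ − ∑_{α≤m} λ_α F_α a F_αᴴ`
(here the "first `m`" indices are those `α` with `(α : ℕ) < m`). -/
theorem kPositive_of_spectral_condition_rank_m (d₁ d₂ k m : ℕ)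
    (hk1 : 1 ≤ k) (hk2 : k ≤ min d₁ d₂) (hm1 : 1 ≤ m) (hm2 : m < d₁ * d₂)
    (F : Fin (d₁ * d₂) → Matrix (Fin d₂) (Fin d₁) ℂ)
    (hF : ∀ α β, ((F α)ᴴ * F β).trace = if α = β then 1 else 0)
    (lam : Fin (d₁ * d₂) → ℝ) (hlam : ∀ α, 0 < lam α)
    (φ : Matrix (Fin d₁) (Fin d₁) ℂ →ₗ[ℂ] Matrix (Fin d₂) (Fin d₂) ℂ)
    (hφ : ∀ a, φ a =
        (∑ α ∈ Finset.univ.filter (fun α : Fin (d₁ * d₂) => m ≤ (α : ℕ)),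
          (lam α : ℂ) • (F α * a * (F α)ᴴ))
        - ∑ α ∈ Finset.univ.filter (fun α : Fin (d₁ * d₂) => (α : ℕ) < m),
          (lam α : ℂ) • (F α * a * (F α)ᴴ))
    (hg : ∑ α ∈ Finset.univ.filter (fun α : Fin (d₁ * d₂) => (α : ℕ) < m),
      gk k (F α) < 1)
    (hcond : ∀ α ∈ Finset.univ.filter (fun α : Fin (d₁ * d₂) => m ≤ (α : ℕ)),
      (∑ β ∈ Finset.univ.filter (fun β : Fin (d₁ * d₂) => (β : ℕ) < m),
          lam β * gk k (F β)) /
        (1 - ∑ β ∈ Finset.univ.filter (fun β : Fin (d₁ * d₂) => (β : ℕ) < m),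
          gk k (F β)) ≤ lam α) :
    kPositive d₁ d₂ k φ := by
  
  have hkd2 : k ≤ d₂ := hk2.trans (min_le_right _ _)
  intro a ha
  obtain ⟨B, hB⟩ : ∃ B : Matrix (Fin k × Fin d₁) (Fin k × Fin d₁) ℂ, a = Bᴴ * B := by
    open scoped MatrixOrder Matrix.Norms.L2Operator in
    obtain ⟨B, hB⟩ := CStarAlgebra.nonneg_iff_eq_star_mul_self.1 ha.nonneg
    exact ⟨B, hB⟩
  let K : Fin (d₁ * d₂) → Matrix (Fin k × Fin d₂) (Fin k × Fin d₁) ℂ := fun α =>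
    Matrix.of fun p r => ∑ x, F α p.2 x * star (B r (p.1, x))
  set S := Finset.univ.filter (fun α : Fin (d₁ * d₂) => (α : ℕ) < m) with hS
  set T := Finset.univ.filter (fun α : Fin (d₁ * d₂) => m ≤ (α : ℕ)) with hT
  have hentry : ∀ α (p q : Fin k × Fin d₂),
      (F α * (Matrix.of fun x y => a (p.1, x) (q.1, y)) * (F α)ᴴ) p.2 q.2
        = (K α * (K α)ᴴ) p q := by
    intro α p q
    simp only [hB, K, Matrix.mul_apply, Matrix.conjTranspose_apply, Matrix.of_apply, star_sum,
      star_mul', star_star, Finset.sum_mul, Finset.mul_sum]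
    rw [Finset.sum_comm]
    conv_lhs => enter [2, x]; rw [Finset.sum_comm]
    rw [Finset.sum_comm]
    refine Finset.sum_congr rfl fun r _ => ?_
    rw [Finset.sum_comm]
    refine Finset.sum_congr rfl fun x _ => Finset.sum_congr rfl fun y _ => ?_
    ring
  have hM : (Matrix.of fun p q : Fin k × Fin d₂ =>
      φ (Matrix.of fun x y => a (p.1, x) (q.1, y)) p.2 q.2)
      = (∑ α ∈ T, (lam α : ℂ) • (K α * (K α)ᴴ)) - ∑ α ∈ S, (lam α : ℂ) • (K α * (K α)ᴴ) := by
    ext p q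
    simp only [Matrix.of_apply, hφ, Matrix.sub_apply, Matrix.sum_apply, Matrix.smul_apply, hentry]
  rw [hM]
  have hherm : ∀ Q : Finset (Fin (d₁ * d₂)),
      (∑ α ∈ Q, (lam α : ℂ) • (K α * (K α)ᴴ)).IsHermitian := by
    intro Q
    unfold Matrix.IsHermitian
    simp [Matrix.conjTranspose_sum, Matrix.conjTranspose_smul, Matrix.conjTranspose_mul]
  refine Matrix.PosSemidef.of_dotProduct_mulVec_nonneg ((hherm T).sub (hherm S)) fun w => ?_
  have hq : ∀ Q : Finset (Fin (d₁ * d₂)),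
      star w ⬝ᵥ ((∑ α ∈ Q, (lam α : ℂ) • (K α * (K α)ᴴ)) *ᵥ w)
        = ((∑ r, ∑ α ∈ Q, lam α * ‖((K α)ᴴ *ᵥ w) r‖ ^ 2 : ℝ) : ℂ) := by
    intro Q
    rw [Finset.sum_comm]
    simp only [← Finset.mul_sum]
    rw [Matrix.sum_mulVec, dotProduct_sum, Complex.ofReal_sum]
    refine Finset.sum_congr rfl fun α _ => ?_
    rw [Matrix.smul_mulVec, dotProduct_smul, quadKK, Complex.ofReal_mul, smul_eq_mul]
  rw [Matrix.sub_mulVec, dotProduct_sub, hq, hq, sub_nonneg]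
  refine Complex.real_le_real.2 (Finset.sum_le_sum fun r _ => ?_)
  let G : Matrix (Fin d₂) (Fin d₁) ℂ := Matrix.of fun p x => ∑ i, B r (i, x) * w (i, p)
  have hz : ∀ α, ‖((K α)ᴴ *ᵥ w) r‖ = ‖∑ x, ∑ p, star (G p x) * F α p x‖ := by
    intro α
    rw [← norm_star]
    congr 1
    simp only [K, G, Matrix.mulVec, dotProduct, Matrix.conjTranspose_apply, Matrix.of_apply,
      star_sum, star_mul', star_star, Finset.sum_mul, Fintype.sum_prod_type]
    rw [Finset.sum_comm]
    conv_lhs => enter [2, p]; rw [Finset.sum_comm]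
    rw [Finset.sum_comm]
    refine Finset.sum_congr rfl fun x _ => Finset.sum_congr rfl fun p _ =>
      Finset.sum_congr rfl fun i _ => ?_
    ring
  refine scalar_ineq S T ?_ lam (fun α => gk k (F α)) _ (∑ x, ∑ p, ‖G p x‖ ^ 2)
    hlam
    (fun _ => by positivity) ?_ (fun α => gk_nonneg k hkd2 _) ?_ hg hcond
  · intro f
    rw [add_comm, hS, hT, ← Finset.sum_filter_add_sum_filter_not _ (fun α : Fin (d₁ * d₂) => (α : ℕ) < m)]
    simp only [not_lt]
  · intro α
    rw [hz]
    exact key_bound k hk1 hkd2 (F α) (fun i p => w (i, p)) (fun i x => B r (i, x)) G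
      (fun p x => rfl)
  · simp only [hz]
    exact parseval (by omega) F hF G
end

section
/- Let F₁ be a d × d complex matrix with tr(F₁ F₁*) = 1, let λ > 0, and define the linear map φ_λ(a) = tr(a) I_d − λ F₁ a F₁* on M_d(ℂ). Let 1 ≤ k < d and suppose 0 < g_k(F₁) ≤ g_{k+1}(F₁) < 1. Then φ_λ is k-positive but not (k+1)-positive if and only if 1/g_{k+1}(F₁) < λ ≤ 1/g_k(F₁). -/
open scoped ComplexOrder
open Matrix

noncomputable def frob {m n : Type*} [Fintype m] [Fintype n] (N : Matrix m n ℂ) : ℝ :=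
  ∑ i, ∑ j, ‖N i j‖ ^ 2

lemma trace_mul_conj {m n : Type*} [Fintype m] [Fintype n] (N : Matrix m n ℂ) :
    (N * Nᴴ).trace = (frob N : ℂ) := by
  simp only [frob, Matrix.trace, Matrix.mul_apply, Matrix.diag, Matrix.conjTranspose_apply]
  push_cast
  refine Finset.sum_congr rfl fun i _ => Finset.sum_congr rfl fun j _ => ?_
  exact Complex.mul_conj' _

lemma frob_cauchy {d : ℕ} (A B : Matrix (Fin d) (Fin d) ℂ) :
    ‖(A * B).trace‖ ^ 2 ≤ frob A * frob B := by
  have h1 : ‖(A * B).trace‖ ≤ ∑ p : Fin d × Fin d, ‖A p.1 p.2‖ * ‖B p.2 p.1‖ := by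
    rw [Fintype.sum_prod_type]
    simp only [Matrix.trace, Matrix.mul_apply, Matrix.diag]
    refine (norm_sum_le _ _).trans (Finset.sum_le_sum fun i _ => (norm_sum_le _ _).trans ?_)
    simp
  have h2 := Finset.sum_mul_sq_le_sq_mul_sq Finset.univ
    (fun p : Fin d × Fin d => ‖A p.1 p.2‖) (fun p => ‖B p.2 p.1‖)
  have h3 : frob B = ∑ p : Fin d × Fin d, ‖B p.2 p.1‖ ^ 2 := by
    rw [Fintype.sum_prod_type, Finset.sum_comm]; rfl
  have h4 : frob A = ∑ p : Fin d × Fin d, ‖A p.1 p.2‖ ^ 2 := by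
    rw [Fintype.sum_prod_type]; rfl
  rw [h3, h4]
  exact (pow_le_pow_left₀ (norm_nonneg _) h1 2).trans h2

lemma exists_top (d k : ℕ) (hk : 1 ≤ k) (hkd : k ≤ d) (f : Fin d → ℝ) (hf : ∀ i, 0 ≤ f i) :
    ∃ s : Finset (Fin d), s.card = k ∧ sumKLargest k f = ∑ i ∈ s, f i ∧
      ∃ t : ℝ, 0 ≤ t ∧ (∀ i ∈ s, t ≤ f i) ∧ ∀ i ∉ s, f i ≤ t := by
  have hne : (Finset.powersetCard k (Finset.univ : Finset (Fin d))).Nonempty := by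
    apply Finset.powersetCard_nonempty.2; simpa
  obtain ⟨s, hs, hmax⟩ := Finset.exists_max_image _ (fun s => ∑ i ∈ s, f i) hne
  have hsc : s.card = k := (Finset.mem_powersetCard.1 hs).2
  have hmax' : ∀ s' : Finset (Fin d), s'.card = k → ∑ i ∈ s', f i ≤ ∑ i ∈ s, f i :=
    fun s' h => hmax s' (Finset.mem_powersetCard.2 ⟨Finset.subset_univ _, h⟩)
  have hsne : s.Nonempty := Finset.card_pos.1 (by omega)
  obtain ⟨m, hm, hmin⟩ := Finset.exists_min_image s f hsne
  refine ⟨s, hsc, ?_, f m, hf m, hmin, fun i hi => ?_⟩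
  · apply IsGreatest.csSup_eq
    refine ⟨⟨s, hsc, rfl⟩, ?_⟩
    rintro x ⟨s', h, rfl⟩
    exact hmax' s' h
  · have hi' : i ∉ s.erase m := fun h => hi (Finset.mem_of_mem_erase h)
    have := hmax' (insert i (s.erase m)) (by
      rw [Finset.card_insert_of_notMem hi', Finset.card_erase_of_mem hm]; omega)
    rw [Finset.sum_insert hi'] at this
    have h2 := Finset.add_sum_erase s f hm
    linarith

lemma weighted_le (d k : ℕ) (hk : 1 ≤ k) (hkd : k ≤ d) (f : Fin d → ℝ) (hf : ∀ i, 0 ≤ f i)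
    (p : Fin d → ℝ) (hp0 : ∀ i, 0 ≤ p i) (hp1 : ∀ i, p i ≤ 1) (hp : ∑ i, p i ≤ k) :
    ∑ i, f i * p i ≤ sumKLargest k f := by
  obtain ⟨s, hsc, hs, t, ht, h1, h2⟩ := exists_top d k hk hkd f hf
  rw [hs]
  have key : ∀ i, f i * p i - (if i ∈ s then f i else 0) ≤ t * (p i - if i ∈ s then 1 else 0) := by
    intro i
    by_cases hi : i ∈ s
    · simp only [hi, if_true]; nlinarith [h1 i hi, hp1 i]
    · simp only [hi, if_false]; nlinarith [h2 i hi, hp0 i]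
  have := Finset.sum_le_sum fun i (_ : i ∈ Finset.univ) => key i
  rw [← Finset.mul_sum, Finset.sum_sub_distrib, Finset.sum_sub_distrib] at this
  simp only [Finset.sum_ite_mem, Finset.univ_inter, Finset.sum_const, hsc, nsmul_eq_mul, mul_one] at this
  nlinarith

lemma exists_unitary {d : ℕ} {A : Matrix (Fin d) (Fin d) ℂ} (hA : A.IsHermitian) :
    ∃ U : Matrix (Fin d) (Fin d) ℂ, Uᴴ * U = 1 ∧ U * Uᴴ = 1 ∧
      A = U * diagonal (fun i => (hA.eigenvalues i : ℂ)) * Uᴴ := by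
  refine ⟨hA.eigenvectorUnitary, ?_, ?_, ?_⟩
  · exact Unitary.coe_star_mul_self hA.eigenvectorUnitary
  · exact Unitary.coe_mul_star_self hA.eigenvectorUnitary
  · exact hA.spectral_theorem

lemma exists_proj {d k : ℕ} (B : Matrix (Fin k) (Fin d) ℂ) :
    ∃ P : Matrix (Fin d) (Fin d) ℂ, Pᴴ = P ∧ P * P = P ∧ B * P = B ∧
      ∃ r : ℕ, r ≤ k ∧ P.trace = r := by
  have hA := isHermitian_conjTranspose_mul_self B
  obtain ⟨U, h1, h2, h3⟩ := exists_unitary hA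
  have hr := hA.rank_eq_card_non_zero_eigs
  set l := hA.eigenvalues
  let D : Matrix (Fin d) (Fin d) ℂ := diagonal fun i => if l i ≠ 0 then 1 else 0
  have hDD : D * D = D := by simp [D, diagonal_mul_diagonal]
  have hLD : diagonal (fun i => (l i : ℂ)) * D = diagonal (fun i => (l i : ℂ)) := by
    simp only [D, diagonal_mul_diagonal]
    congr 1; ext i; by_cases h : l i = 0 <;> simp [h]
  have hP2 : (U * D * Uᴴ) * (U * D * Uᴴ) = U * D * Uᴴ := by
    calc _ = U * D * (Uᴴ * U) * D * Uᴴ := by simp only [Matrix.mul_assoc]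
      _ = _ := by rw [h1, Matrix.mul_one, Matrix.mul_assoc U, hDD]
  have hAP : Bᴴ * B * (U * D * Uᴴ) = Bᴴ * B := by
    rw [h3]
    calc _ = U * diagonal (fun i => (l i : ℂ)) * (Uᴴ * U) * D * Uᴴ := by simp only [Matrix.mul_assoc]
      _ = _ := by rw [h1, Matrix.mul_one, Matrix.mul_assoc U, hLD]
  refine ⟨U * D * Uᴴ, ?_, hP2, ?_, Fintype.card {i // l i ≠ 0}, ?_, ?_⟩
  · have : Dᴴ = D := by
      simp only [D, diagonal_conjTranspose]
      congr 1; ext i; by_cases h : l i = 0 <;> simp [h]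
    simp [Matrix.conjTranspose_mul, this, Matrix.mul_assoc]
  · have : B * (U * D * Uᴴ - 1) = 0 := by
      rw [← Matrix.conjTranspose_mul_self_eq_zero, Matrix.conjTranspose_mul, Matrix.mul_assoc,
        ← Matrix.mul_assoc Bᴴ, Matrix.mul_sub, hAP]
      simp
    rwa [Matrix.mul_sub, Matrix.mul_one, sub_eq_zero] at this
  · rw [← hr, rank_conjTranspose_mul_self]
    simpa using B.rank_le_height
  · rw [Matrix.trace_mul_comm, ← Matrix.mul_assoc, h1, Matrix.one_mul]
    simp only [D, Matrix.trace_diagonal, Fintype.card_subtype, Finset.sum_boole]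

lemma proj_diag {d : ℕ} {P : Matrix (Fin d) (Fin d) ℂ} (h : Pᴴ = P) (h2 : P * P = P) (i : Fin d) :
    ∃ p : ℝ, 0 ≤ p ∧ p ≤ 1 ∧ P i i = p := by
  have gen : ∀ Q : Matrix (Fin d) (Fin d) ℂ, Qᴴ = Q → Q * Q = Q →
      Q i i = ((∑ j, ‖Q i j‖ ^ 2 : ℝ) : ℂ) := by
    intro Q hQ hQ2
    have : Q i i = (Q * Qᴴ) i i := by rw [hQ, hQ2]
    rw [this, Matrix.mul_apply]
    push_cast
    exact Finset.sum_congr rfl fun j _ => Complex.mul_conj' _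
  have e1 := gen P h h2
  have e2 := gen (1 - P) (by simp [h]) (by simp [Matrix.mul_sub, Matrix.sub_mul, h2])
  refine ⟨_, Finset.sum_nonneg fun j _ => sq_nonneg _, ?_, e1⟩
  have h3 : 0 ≤ ∑ j, ‖(1 - P) i j‖ ^ 2 := Finset.sum_nonneg fun j _ => sq_nonneg _
  rw [Matrix.sub_apply, Matrix.one_apply_eq, e1] at e2
  have : 1 - (∑ j, ‖P i j‖ ^ 2) = ∑ j, ‖(1 - P) i j‖ ^ 2 := by exact_mod_cast e2
  linarith

lemma kyfan_s11 {d k : ℕ} (hk : 1 ≤ k) (hkd : k ≤ d) (F : Matrix (Fin d) (Fin d) ℂ)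
    (A : Matrix (Fin d) (Fin k) ℂ) (B : Matrix (Fin k) (Fin d) ℂ) :
    ‖(F * (A * B)).trace‖ ^ 2 ≤ gk k F * frob (A * B) := by
  obtain ⟨P, hP, hP2, hBP, r, hr, htr⟩ := exists_proj B
  have e : (F * (A * B)).trace = ((P * F) * (A * B)).trace := by
    conv_lhs => rw [← hBP, ← Matrix.mul_assoc, ← Matrix.mul_assoc, Matrix.trace_mul_comm]
    simp only [Matrix.mul_assoc]
  rw [e]
  refine (frob_cauchy _ _).trans ?_
  refine mul_le_mul_of_nonneg_right ?_
    (Finset.sum_nonneg fun _ _ => Finset.sum_nonneg fun _ _ => sq_nonneg _)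
  have hH := Matrix.isHermitian_mul_conjTranspose_self F
  have hl : ∀ i, 0 ≤ hH.eigenvalues i := (posSemidef_self_mul_conjTranspose F).eigenvalues_nonneg
  obtain ⟨U, h1, h2, h3⟩ := exists_unitary hH
  have hQ : (Uᴴ * P * U)ᴴ = Uᴴ * P * U := by
    simp [Matrix.conjTranspose_mul, hP, Matrix.mul_assoc]
  have hQ2 : (Uᴴ * P * U) * (Uᴴ * P * U) = Uᴴ * P * U := by
    calc _ = Uᴴ * P * (U * Uᴴ) * P * U := by simp only [Matrix.mul_assoc]
      _ = _ := by rw [h2, Matrix.mul_one, Matrix.mul_assoc Uᴴ, hP2]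
  choose p hp0 hp1 hp using proj_diag hQ hQ2
  have ht : (Uᴴ * P * U).trace = r := by
    rw [Matrix.trace_mul_comm, ← Matrix.mul_assoc, h2, Matrix.one_mul, htr]
  have hs : ∑ i, p i = r := by
    rw [Matrix.trace] at ht
    simp only [Matrix.diag, hp] at ht
    exact_mod_cast ht
  have hfr : frob (P * F) = ∑ i, hH.eigenvalues i * p i := by
    have := trace_mul_conj (P * F)
    rw [Matrix.conjTranspose_mul, hP, Matrix.trace_mul_comm] at this
    have e2 : F ᴴ * P * (P * F) = Fᴴ * P * F := by
      rw [Matrix.mul_assoc, ← Matrix.mul_assoc P, hP2, Matrix.mul_assoc]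
    rw [e2, Matrix.mul_assoc, Matrix.trace_mul_comm, Matrix.mul_assoc, h3,
      Matrix.trace_mul_comm, Matrix.mul_assoc, Matrix.mul_assoc, Matrix.trace_mul_comm,
      Matrix.mul_assoc, Matrix.mul_assoc, ← Matrix.mul_assoc Uᴴ P U] at this
    simp only [Matrix.trace, Matrix.diag, Matrix.diagonal_mul, hp] at this
    exact_mod_cast this.symm
  rw [hfr]
  exact weighted_le d k hk hkd _ hl p hp0 hp1 (by rw [hs]; exact_mod_cast hr)

lemma kyfan_attained {d k : ℕ} (hk : 1 ≤ k) (hkd : k ≤ d) (F : Matrix (Fin d) (Fin d) ℂ) :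
    ∃ (A : Matrix (Fin d) (Fin k) ℂ) (B : Matrix (Fin k) (Fin d) ℂ),
      (F * (A * B)).trace = (gk k F : ℂ) ∧ frob (A * B) = gk k F := by
  have hH := Matrix.isHermitian_mul_conjTranspose_self F
  have hl : ∀ i, 0 ≤ hH.eigenvalues i := (posSemidef_self_mul_conjTranspose F).eigenvalues_nonneg
  obtain ⟨U, h1, h2, h3⟩ := exists_unitary hH
  obtain ⟨s, hsc, hs, -⟩ := exists_top d k hk hkd _ hl
  let e := s.orderEmbOfFin hsc
  let V : Matrix (Fin d) (Fin k) ℂ := U.submatrix id e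
  have hV : ∀ M : Matrix (Fin d) (Fin d) ℂ, Vᴴ * M * V = (Uᴴ * M * U).submatrix e e := by
    intro M; ext i j; simp [V, Matrix.mul_apply]
  have hVV : Vᴴ * V = 1 := by
    have := hV 1
    rw [Matrix.mul_one, Matrix.mul_one, h1] at this
    rw [this, Matrix.submatrix_one _ e.injective]
  have hVF : (Vᴴ * (F * Fᴴ) * V).trace = (gk k F : ℂ) := by
    rw [hV, h3]
    have : Uᴴ * (U * diagonal (fun i => (hH.eigenvalues i : ℂ)) * Uᴴ) * U
      = diagonal (fun i => (hH.eigenvalues i : ℂ)) := by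
      calc _ = (Uᴴ * U) * diagonal (fun i => (hH.eigenvalues i : ℂ)) * (Uᴴ * U) := by
            simp only [Matrix.mul_assoc]
        _ = _ := by rw [h1]; simp
    rw [this, gk, hs]
    simp only [Matrix.trace, Matrix.diag, Matrix.submatrix_apply, Matrix.diagonal_apply_eq]
    push_cast
    rw [← Finset.map_orderEmbOfFin_univ s hsc, Finset.sum_map]
    rfl
  refine ⟨Fᴴ * V, Vᴴ, ?_, ?_⟩
  · rw [← hVF, ← Matrix.mul_assoc, Matrix.trace_mul_comm]; simp only [Matrix.mul_assoc]
  · have := trace_mul_conj (Fᴴ * V * Vᴴ)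
    have e2 : (Fᴴ * V * Vᴴ) * (Fᴴ * V * Vᴴ)ᴴ = Fᴴ * V * (Vᴴ * F) := by
      simp only [Matrix.conjTranspose_mul, Matrix.conjTranspose_conjTranspose]
      calc _ = Fᴴ * V * (Vᴴ * V) * (Vᴴ * F) := by simp only [Matrix.mul_assoc]
        _ = _ := by rw [hVV, Matrix.mul_one]
    rw [e2, Matrix.trace_mul_comm] at this
    have e3 : Vᴴ * F * (Fᴴ * V) = Vᴴ * (F * Fᴴ) * V := by simp only [Matrix.mul_assoc]
    rw [e3, hVF] at this
    exact_mod_cast this.symm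

open scoped MatrixOrder Matrix.Norms.L2Operator in
lemma exists_sq {n : Type*} [Fintype n] [DecidableEq n] (a : Matrix n n ℂ) (ha : a.PosSemidef) :
    ∃ C : Matrix n n ℂ, a = Cᴴ * C :=
  CStarAlgebra.nonneg_iff_eq_star_mul_self.mp ha.nonneg

noncomputable def ampl {d : ℕ} (k : ℕ)
    (φ : Matrix (Fin d) (Fin d) ℂ →ₗ[ℂ] Matrix (Fin d) (Fin d) ℂ)
    (a : Matrix (Fin k × Fin d) (Fin k × Fin d) ℂ) :
    Matrix (Fin k × Fin d) (Fin k × Fin d) ℂ :=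
  Matrix.of fun p q => φ (Matrix.of fun x y => a (p.1, x) (q.1, y)) p.2 q.2

lemma ampl_vec {d k : ℕ} (F : Matrix (Fin d) (Fin d) ℂ) (lam : ℝ)
    (φ : Matrix (Fin d) (Fin d) ℂ →ₗ[ℂ] Matrix (Fin d) (Fin d) ℂ)
    (hφ : ∀ a, φ a = a.trace • (1 : Matrix (Fin d) (Fin d) ℂ) - (lam : ℂ) • (F * a * Fᴴ))
    (A : Matrix (Fin d) (Fin k) ℂ) (p q : Fin k × Fin d) :
    ampl k φ (vecMulVec (fun p => A p.2 p.1) (star fun p => A p.2 p.1)) p q =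
      (Aᵀ * (Aᵀ)ᴴ) p.1 q.1 * (if p.2 = q.2 then 1 else 0)
       - lam * ((F * A) p.2 p.1 * star ((F * A) q.2 q.1)) := by
  have hb : (Matrix.of fun x y => vecMulVec (fun p : Fin k × Fin d => A p.2 p.1)
      (star fun p => A p.2 p.1) (p.1, x) (q.1, y))
      = vecMulVec (fun x => A x p.1) (star fun x => A x q.1) := by
    ext x y; simp [vecMulVec_apply]
  simp only [ampl, Matrix.of_apply]
  rw [hb, hφ, Matrix.sub_apply, Matrix.smul_apply, Matrix.smul_apply, Matrix.mul_vecMulVec,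
    Matrix.vecMulVec_mul, vecMulVec_apply, Matrix.one_apply, ← Matrix.star_mulVec]
  simp [Matrix.trace, Matrix.mul_apply, vecMulVec_apply, Matrix.mulVec, dotProduct,
    Matrix.conjTranspose_apply]

lemma form_eq {d k : ℕ} (F : Matrix (Fin d) (Fin d) ℂ) (lam : ℝ)
    (φ : Matrix (Fin d) (Fin d) ℂ →ₗ[ℂ] Matrix (Fin d) (Fin d) ℂ)
    (hφ : ∀ a, φ a = a.trace • (1 : Matrix (Fin d) (Fin d) ℂ) - (lam : ℂ) • (F * a * Fᴴ))
    (A : Matrix (Fin d) (Fin k) ℂ) (B : Matrix (Fin k) (Fin d) ℂ) :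
    (star fun p : Fin k × Fin d => star (B p.1 p.2)) ⬝ᵥ
      (ampl k φ (vecMulVec (fun p => A p.2 p.1) (star fun p => A p.2 p.1)) *ᵥ
        fun p => star (B p.1 p.2))
    = ((frob (A * B) - lam * ‖(F * (A * B)).trace‖ ^ 2 : ℝ) : ℂ) := by
  have ht : (F * (A * B)).trace = ∑ p : Fin k × Fin d, B p.1 p.2 * (F * A) p.2 p.1 := by
    rw [← Matrix.mul_assoc, Matrix.trace_mul_comm, Fintype.sum_prod_type]
    simp [Matrix.trace, Matrix.mul_apply]
  have hf : (frob (A * B) : ℂ) = ∑ p : Fin k × Fin d, ∑ q : Fin k × Fin d,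
      B p.1 p.2 * ((Aᵀ * (Aᵀ)ᴴ) p.1 q.1 * (if p.2 = q.2 then 1 else 0)) * star (B q.1 q.2) := by
    have h1 : ((A * B)ᵀ * ((A * B)ᵀ)ᴴ).trace = (frob (A * B) : ℂ) := by
      rw [trace_mul_conj]
      congr 1
      simp only [frob, Matrix.transpose_apply]
      exact Finset.sum_comm
    rw [← h1]
    have h2 : (A * B)ᵀ * ((A * B)ᵀ)ᴴ = Bᵀ * ((Aᵀ * (Aᵀ)ᴴ) * (Bᵀ)ᴴ) := by
      simp only [Matrix.transpose_mul, Matrix.conjTranspose_mul, Matrix.mul_assoc]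
    rw [h2]
    simp only [Fintype.sum_prod_type, Matrix.trace, Matrix.diag]
    rw [Finset.sum_comm]
    conv_lhs =>
      enter [2, x]
      rw [Matrix.mul_apply]
    rw [Finset.sum_comm]
    conv_rhs => rw [Finset.sum_comm]
    refine Finset.sum_congr rfl fun p _ => Finset.sum_congr rfl fun x _ => ?_
    rw [Matrix.mul_apply, Finset.mul_sum]
    refine Finset.sum_congr rfl fun q _ => ?_
    simp [mul_assoc]
  push_cast
  rw [← Complex.mul_conj', hf, ht, map_sum, Finset.sum_mul_sum, Finset.mul_sum,
    ← Finset.sum_sub_distrib]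
  simp only [dotProduct, Matrix.mulVec]
  refine Finset.sum_congr rfl fun p _ => ?_
  rw [Finset.mul_sum, Finset.mul_sum, ← Finset.sum_sub_distrib]
  refine Finset.sum_congr rfl fun q _ => ?_
  rw [ampl_vec F lam φ hφ]
  simp only [Pi.star_apply, star_star, map_mul, starRingEnd_apply]
  ring

lemma ampl_herm {d k : ℕ} (F : Matrix (Fin d) (Fin d) ℂ) (lam : ℝ)
    (φ : Matrix (Fin d) (Fin d) ℂ →ₗ[ℂ] Matrix (Fin d) (Fin d) ℂ)
    (hφ : ∀ a, φ a = a.trace • (1 : Matrix (Fin d) (Fin d) ℂ) - (lam : ℂ) • (F * a * Fᴴ))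
    (A : Matrix (Fin d) (Fin k) ℂ) :
    (ampl k φ (vecMulVec (fun p => A p.2 p.1) (star fun p => A p.2 p.1))).IsHermitian := by
  ext p q
  rw [Matrix.conjTranspose_apply, ampl_vec F lam φ hφ, ampl_vec F lam φ hφ]
  have h : star ((Aᵀ * (Aᵀ)ᴴ) q.1 p.1) = (Aᵀ * (Aᵀ)ᴴ) p.1 q.1 := by
    simp [Matrix.mul_apply, Matrix.conjTranspose_apply, mul_comm]
  rw [star_sub, star_mul, star_mul, star_mul, star_star, h]
  simp only [eq_comm (a := q.2)]
  split_ifs <;> simp [mul_comm]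

lemma kPositive_iff {d k : ℕ} (hk : 1 ≤ k) (hkd : k ≤ d) (F : Matrix (Fin d) (Fin d) ℂ)
    (lam : ℝ) (hlam : 0 < lam)
    (φ : Matrix (Fin d) (Fin d) ℂ →ₗ[ℂ] Matrix (Fin d) (Fin d) ℂ)
    (hφ : ∀ a, φ a = a.trace • (1 : Matrix (Fin d) (Fin d) ℂ) - (lam : ℂ) • (F * a * Fᴴ))
    (hg : 0 < gk k F) :
    kPositive d d k φ ↔ lam ≤ 1 / gk k F := by
  rw [le_div_iff₀ hg]
  constructor
  · intro h
    obtain ⟨A, B, h1, h2⟩ := kyfan_attained hk hkd F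
    have h3 : (ampl k φ _).PosSemidef := h _ (posSemidef_vecMulVec_self_star
      (fun p : Fin k × Fin d => A p.2 p.1))
    have h4 := h3.dotProduct_mulVec_nonneg (fun p => star (B p.1 p.2))
    rw [form_eq F lam φ hφ, h1, h2, Complex.norm_real, Real.norm_eq_abs, sq_abs] at h4
    have h5 : 0 ≤ gk k F - lam * gk k F ^ 2 := by exact_mod_cast h4
    by_contra hc
    push Not at hc
    nlinarith
  · intro h a ha
    have hvec : ∀ v : Fin k × Fin d → ℂ, (ampl k φ (vecMulVec v (star v))).PosSemidef := by
      intro v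
      have := ampl_herm F lam φ hφ (Matrix.of fun x p => v (p, x))
      refine .of_dotProduct_mulVec_nonneg this fun w => ?_
      have e := form_eq F lam φ hφ (Matrix.of fun x p => v (p, x))
        (Matrix.of fun p x => star (w (p, x)))
      simp only [Matrix.of_apply, star_star] at e
      refine le_of_le_of_eq ?_ e.symm
      have hky := kyfan_s11 hk hkd F (Matrix.of fun x p => v (p, x))
        (Matrix.of fun p x => star (w (p, x)))
      have hf : 0 ≤ frob ((Matrix.of fun x p => v (p, x)) *
        (Matrix.of fun p x => star (w (p, x)))) :=
        (Finset.sum_nonneg fun _ _ => Finset.sum_nonneg fun _ _ => sq_nonneg _)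
      rw [Complex.zero_le_real]
      nlinarith [mul_le_mul_of_nonneg_left hky hlam.le, mul_le_mul_of_nonneg_right h hf]
    obtain ⟨C, rfl⟩ : ∃ C : Matrix (Fin k × Fin d) (Fin k × Fin d) ℂ, a = Cᴴ * C :=
      exists_sq a ha
    have hs : Cᴴ * C = ∑ r, vecMulVec (star (C r)) (star (star (C r))) := by
      ext i j
      simp [Matrix.mul_apply, Matrix.sum_apply, vecMulVec_apply]
    have : (∑ r, ampl k φ (vecMulVec (star (C r)) (star (star (C r))))).PosSemidef :=
      posSemidef_sum _ fun r _ => hvec _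
    convert this using 1
    ext p q
    rw [hs]
    have e : (Matrix.of fun x y => (∑ r, vecMulVec (star (C r)) (star (star (C r)))) (p.1, x) (q.1, y))
        = ∑ r, Matrix.of fun x y => (vecMulVec (star (C r)) (star (star (C r)))) (p.1, x) (q.1, y) := by
      ext x y; simp [Matrix.sum_apply]
    rw [Matrix.of_apply, e, map_sum, Matrix.sum_apply, Matrix.sum_apply]
    rfl

/-- The generalized Choi map `φ_λ(a) = tr(a) I − λ F₁ a F₁ᴴ` is `k`-positive but not
`(k+1)`-positive iff `1/g_{k+1}(F₁) < λ ≤ 1/g_k(F₁)`. -/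
theorem generalized_choi_kPositive_iff (d k : ℕ) (hk1 : 1 ≤ k) (hk2 : k < d)
    (F₁ : Matrix (Fin d) (Fin d) ℂ) (hF₁ : (F₁ * F₁ᴴ).trace = 1)
    (lam : ℝ) (hlam : 0 < lam)
    (φ : Matrix (Fin d) (Fin d) ℂ →ₗ[ℂ] Matrix (Fin d) (Fin d) ℂ)
    (hφ : ∀ a, φ a = a.trace • (1 : Matrix (Fin d) (Fin d) ℂ)
        - (lam : ℂ) • (F₁ * a * F₁ᴴ))
    (hg0 : 0 < gk k F₁) (hgk : gk k F₁ ≤ gk (k + 1) F₁) (hg1 : gk (k + 1) F₁ < 1) :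
    (kPositive d d k φ ∧ ¬ kPositive d d (k + 1) φ) ↔
      (1 / gk (k + 1) F₁ < lam ∧ lam ≤ 1 / gk k F₁) := by
  rw [kPositive_iff hk1 hk2.le F₁ lam hlam φ hφ hg0,
    kPositive_iff (by omega) hk2 F₁ lam hlam φ hφ (hg0.trans_le hgk), not_le, and_comm]
end

section
/- Let ρ be a positive semidefinite matrix on ℂ^{d₁} ⊗ ℂ^{d₂} ⊗ … ⊗ ℂ^{d_n} with tr(ρ) = 1. Then ρ is separable if and only if (id_{d₁} ⊗ φ) ρ is positive semidefinite for every linear map φ : M_{d₂ ⋯ d_n}(ℂ) → M_{d₁}(ℂ) with φ(a*) = φ(a)* such that φ(p₂ ⊗ … ⊗ p_n) is positive semidefinite for all rank-one orthogonal projections p_k ∈ M_{d_k}(ℂ), k = 2, …, n. -/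
open scoped Kronecker ComplexOrder
open Matrix

/-- The Kronecker product `p₂ ⊗ … ⊗ p_n` of a family of matrices, as a matrix on the
product index type. -/
def productMatrix {n : ℕ} (d : Fin n → ℕ)
    (p : ∀ k, Matrix (Fin (d k)) (Fin (d k)) ℂ) :
    Matrix (∀ k, Fin (d k)) (∀ k, Fin (d k)) ℂ :=
  Matrix.of fun x y => ∏ k, p k (x k) (y k)

/-- An `(n+1)`-partite state on `ℂ^{d₁} ⊗ ℂ^{d 0} ⊗ … ⊗ ℂ^{d (n-1)}` is separable if it
is a finite convex combination of products of unit-trace positive semidefinite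
matrices. -/
def SeparableMulti {d₁ n : ℕ} {d : Fin n → ℕ}
    (ρ : Matrix (Fin d₁ × (∀ k, Fin (d k))) (Fin d₁ × (∀ k, Fin (d k))) ℂ) : Prop :=
  ∃ (m : ℕ) (c : Fin m → ℝ) (σ₁ : Fin m → Matrix (Fin d₁) (Fin d₁) ℂ)
    (σ : Fin m → ∀ k, Matrix (Fin (d k)) (Fin (d k)) ℂ),
    (∀ t, 0 ≤ c t) ∧ (∑ t, c t = 1) ∧
    (∀ t, (σ₁ t).PosSemidef ∧ (σ₁ t).trace = 1) ∧
    (∀ t k, (σ t k).PosSemidef ∧ (σ t k).trace = 1) ∧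
    ρ = ∑ t, (c t : ℂ) • (σ₁ t ⊗ₖ productMatrix d (σ t))

/-- The action of `id_{d₁} ⊗ φ` on a matrix on `ℂ^{d₁} ⊗ (ℂ^{d 0} ⊗ … ⊗ ℂ^{d (n-1)})`,
applying `φ` to the second factor. -/
def idTensorMap {d₁ n : ℕ} {d : Fin n → ℕ}
    (φ : Matrix (∀ k, Fin (d k)) (∀ k, Fin (d k)) ℂ →ₗ[ℂ] Matrix (Fin d₁) (Fin d₁) ℂ)
    (ρ : Matrix (Fin d₁ × (∀ k, Fin (d k))) (Fin d₁ × (∀ k, Fin (d k))) ℂ) :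
    Matrix (Fin d₁ × Fin d₁) (Fin d₁ × Fin d₁) ℂ :=
  Matrix.of fun p q => φ (Matrix.of fun x y => ρ (p.1, x) (q.1, y)) p.2 q.2


/-- Convex hull of a compact set in finite dimension is compact. -/
theorem aux_isCompact_convexHull {E : Type*} [NormedAddCommGroup E] [NormedSpace ℝ E]
    [FiniteDimensional ℝ E] {s : Set E} (hs : IsCompact s) : IsCompact (convexHull ℝ s) := by
  have key : convexHull ℝ s = ⋃ m ∈ Finset.range (Module.finrank ℝ E + 2),
      (fun q : (Fin m → ℝ) × (Fin m → E) => ∑ i, q.1 i • q.2 i) ''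
        (stdSimplex ℝ (Fin m) ×ˢ Set.univ.pi fun _ => s) := by
    ext x
    constructor
    · intro hx
      obtain ⟨ι, _, z, w, hz, hai, hw, hw1, hx⟩ := eq_pos_convex_span_of_mem_convexHull hx
      have hcard := hai.card_le_finrank_succ
      have hle : Module.finrank ℝ (vectorSpan ℝ (Set.range z)) ≤ Module.finrank ℝ E :=
        Submodule.finrank_le _
      simp only [Set.mem_iUnion]
      let e := Fintype.equivFin ι
      refine ⟨Fintype.card ι, by simp; omega, (w ∘ e.symm, z ∘ e.symm), ⟨⟨?_, ?_⟩, ?_⟩, ?_⟩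
      · intro i; exact (hw _).le
      · rw [← hw1]; exact e.symm.sum_comp w
      · intro i _; exact hz ⟨_, rfl⟩
      · rw [← hx]; exact e.symm.sum_comp (fun i => w i • z i)
    · simp only [Set.mem_iUnion]
      rintro ⟨m, _, q, ⟨hq1, hq2⟩, rfl⟩
      exact mem_convexHull_of_exists_fintype q.1 q.2 hq1.1 hq1.2
        (fun i => hq2 i (Set.mem_univ i)) rfl
  rw [key]
  refine Finset.isCompact_biUnion _ fun m _ => ?_
  refine IsCompact.image ((isCompact_stdSimplex ℝ (Fin m)).prod (isCompact_univ_pi fun _ => hs)) ?_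
  fun_prop

/-- Rank-one projections. -/
def auxR (m : Type*) [Fintype m] : Set (Matrix m m ℂ) :=
  {p | p.IsHermitian ∧ p * p = p ∧ p.trace = 1}

theorem auxR_psd {m : Type*} [Fintype m] {p : Matrix m m ℂ} (hp : p ∈ auxR m) :
    p.PosSemidef := by
  have h := posSemidef_conjTranspose_mul_self p
  rwa [hp.1.eq, hp.2.1] at h

theorem auxR_compact (m : Type*) [Fintype m] : IsCompact (auxR m) := by
  let _ : NormedAddCommGroup (Matrix m m ℂ) := Matrix.normedAddCommGroup
  let _ : NormedSpace ℝ (Matrix m m ℂ) := Matrix.normedSpace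
  have hc : IsClosed (auxR m) := by
    refine IsClosed.inter ?_ (IsClosed.inter ?_ ?_)
    · exact isClosed_eq (by fun_prop) (by fun_prop)
    · exact isClosed_eq (by fun_prop) (by fun_prop)
    · exact isClosed_eq (by fun_prop) (by fun_prop)
  have : ProperSpace (Matrix m m ℂ) := FiniteDimensional.proper_real _
  refine Metric.isCompact_of_isClosed_isBounded hc ?_
  refine (Metric.isBounded_closedBall (x := (0 : Matrix m m ℂ)) (r := 1)).subset ?_
  intro p hp
  rw [mem_closedBall_zero_iff, Matrix.norm_le_iff zero_le_one]
  intro i j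
  have h1 : (pᴴ * p).trace = 1 := by rw [hp.1.eq, hp.2.1, hp.2.2]
  have h2 : ∑ j, ∑ i, ‖p i j‖ ^ 2 = (1 : ℝ) := by
    have : ((∑ j, ∑ i, ‖p i j‖ ^ 2 : ℝ) : ℂ) = 1 := by
      rw [← h1]
      simp [Matrix.trace, Matrix.mul_apply, ← Complex.conj_mul']
    exact_mod_cast this
  have h3 : ‖p i j‖ ^ 2 ≤ 1 := by
    rw [← h2]
    refine le_trans ?_ (Finset.single_le_sum (f := fun j => ∑ i, ‖p i j‖ ^ 2)
      (fun _ _ => Finset.sum_nonneg fun _ _ => by positivity) (Finset.mem_univ j))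
    exact Finset.single_le_sum (f := fun i => ‖p i j‖ ^ 2)
      (fun _ _ => by positivity) (Finset.mem_univ i)
  exact (sq_le_one_iff₀ (norm_nonneg _)).1 h3

theorem auxR_vec {m : Type*} [Fintype m] (v : m → ℂ) (hv : star v ⬝ᵥ v = 1) :
    vecMulVec v (star v) ∈ auxR m := by
  refine ⟨(posSemidef_vecMulVec_self_star v).1, ?_, ?_⟩
  · rw [vecMulVec_mul_vecMulVec, hv]; simp
  · rw [trace_vecMulVec, dotProduct_comm, hv]

theorem aux_spectral {m : Type*} [Fintype m] [DecidableEq m] {σ : Matrix m m ℂ}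
    (hσ : σ.PosSemidef) : ∃ (l : m → ℝ) (p : m → Matrix m m ℂ),
      (∀ i, 0 ≤ l i) ∧ (∀ i, p i ∈ auxR m) ∧ ∀ x y, σ x y = ∑ i, (l i : ℂ) * p i x y := by
  have hU := hσ.1.eigenvectorUnitary.2
  set U : Matrix m m ℂ := (hσ.1.eigenvectorUnitary : Matrix m m ℂ) with hUdef
  refine ⟨hσ.1.eigenvalues, fun i => vecMulVec (fun x => U x i) (star fun x => U x i),
    hσ.eigenvalues_nonneg, fun i => auxR_vec _ ?_, ?_⟩
  · have h := congrFun (congrFun (Matrix.mem_unitaryGroup_iff'.1 hU) i) i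
    rw [Matrix.mul_apply] at h
    simpa [dotProduct, Matrix.star_apply] using h
  · intro x y
    have h := congrFun (congrFun hσ.1.spectral_theorem x) y
    rw [h, Unitary.conjStarAlgAut_apply]
    simp only [Matrix.mul_apply, Matrix.diagonal_apply, vecMulVec_apply]
    simp [-IsHermitian.eigenvectorUnitary_apply, ← hUdef, Matrix.star_apply]
    exact Finset.sum_congr rfl fun i _ => by ring

theorem aux_phi_psd {d₁ n : ℕ} {d : Fin n → ℕ}
    (φ : Matrix (∀ k, Fin (d k)) (∀ k, Fin (d k)) ℂ →ₗ[ℂ] Matrix (Fin d₁) (Fin d₁) ℂ)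
    (hφ : ∀ p : ∀ k, Matrix (Fin (d k)) (Fin (d k)) ℂ,
          (∀ k, (p k).IsHermitian ∧ p k * p k = p k ∧ (p k).trace = 1) →
          (φ (productMatrix d p)).PosSemidef)
    (σ : ∀ k, Matrix (Fin (d k)) (Fin (d k)) ℂ) (hσ : ∀ k, (σ k).PosSemidef) :
    (φ (productMatrix d σ)).PosSemidef := by
  choose l p hl hp hs using fun k => aux_spectral (hσ k)
  have h : productMatrix d σ = ∑ f : (∀ k, Fin (d k)),
      ((∏ k, l k (f k) : ℝ) : ℂ) • productMatrix d (fun k => p k (f k)) := by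
    ext x y
    simp only [productMatrix, Matrix.of_apply, Matrix.sum_apply, Matrix.smul_apply, hs]
    rw [Finset.prod_univ_sum, Fintype.piFinset_univ]
    refine Finset.sum_congr rfl fun f _ => ?_
    rw [Finset.prod_mul_distrib]
    simp
  rw [h, map_sum]
  refine posSemidef_sum _ fun f _ => ?_
  rw [map_smul]
  refine (hφ _ fun k => hp k (f k)).smul ?_
  exact_mod_cast Finset.prod_nonneg fun k _ => hl k (f k)

theorem aux_idTensor {d₁ n : ℕ} {d : Fin n → ℕ} {ι : Type*} [Fintype ι]
    (φ : Matrix (∀ k, Fin (d k)) (∀ k, Fin (d k)) ℂ →ₗ[ℂ] Matrix (Fin d₁) (Fin d₁) ℂ)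
    (c : ι → ℂ) (A : ι → Matrix (Fin d₁) (Fin d₁) ℂ)
    (B : ι → Matrix (∀ k, Fin (d k)) (∀ k, Fin (d k)) ℂ) :
    idTensorMap φ (∑ t, c t • (A t ⊗ₖ B t)) = ∑ t, c t • (A t ⊗ₖ φ (B t)) := by
  ext p q
  have h : (Matrix.of fun x y => (∑ t, c t • (A t ⊗ₖ B t)) (p.1, x) (q.1, y)) =
      ∑ t, (c t * A t p.1 q.1) • B t := by
    ext x y
    simp [Matrix.sum_apply, mul_assoc]
  simp only [idTensorMap, Matrix.of_apply]
  rw [h]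
  simp [Matrix.sum_apply, mul_assoc]

theorem aux_block_s14 {ι κ : Type*} [Fintype ι] [Fintype κ] [DecidableEq ι]
    (F : Matrix (ι × κ) (ι × κ) ℂ →ₗ[ℂ] ℂ) (M : Matrix (ι × κ) (ι × κ) ℂ) :
    F M = ∑ i, ∑ j, F (Matrix.single i j 1 ⊗ₖ Matrix.of fun x y => M (i, x) (j, y)) := by
  simp only [← map_sum]
  congr 1
  ext ⟨i, x⟩ ⟨j, y⟩
  simp only [Matrix.sum_apply, Matrix.kroneckerMap_apply, Matrix.single_apply, Matrix.of_apply]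
  rw [Finset.sum_eq_single i, Finset.sum_eq_single j]
  · simp
  · intro b _ hb; simp [hb]
  · simp
  · intro b _ hb; simp [hb]
  · simp

theorem aux_kron {ι κ : Type*} [Fintype ι] [Fintype κ] [DecidableEq ι]
    (F : Matrix (ι × κ) (ι × κ) ℂ →ₗ[ℂ] ℂ) (w : Matrix ι ι ℂ) (a : Matrix κ κ ℂ) :
    F (w ⊗ₖ a) = ∑ i, ∑ j, w i j * F (Matrix.single i j 1 ⊗ₖ a) := by
  rw [aux_block_s14 F]
  refine Finset.sum_congr rfl fun i _ => Finset.sum_congr rfl fun j _ => ?_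
  rw [← smul_eq_mul, ← map_smul, ← Matrix.kronecker_smul]
  rfl

/-- The set of pure product states. -/
def auxP (d₁ n : ℕ) (d : Fin n → ℕ) :
    Set (Matrix (Fin d₁ × (∀ k, Fin (d k))) (Fin d₁ × (∀ k, Fin (d k))) ℂ) :=
  (fun q : Matrix (Fin d₁) (Fin d₁) ℂ × (∀ k, Matrix (Fin (d k)) (Fin (d k)) ℂ) =>
    q.1 ⊗ₖ productMatrix d q.2) '' (auxR (Fin d₁) ×ˢ Set.univ.pi fun k => auxR (Fin (d k)))

theorem auxP_compact (d₁ n : ℕ) (d : Fin n → ℕ) : IsCompact (auxP d₁ n d) := by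
  refine IsCompact.image ((auxR_compact _).prod (isCompact_univ_pi fun k => auxR_compact _)) ?_
  refine continuous_matrix fun x y => ?_
  simp only [Matrix.kroneckerMap_apply, productMatrix, Matrix.of_apply]
  fun_prop

theorem aux_sep_of_mem {d₁ n : ℕ} {d : Fin n → ℕ}
    {ρ : Matrix (Fin d₁ × (∀ k, Fin (d k))) (Fin d₁ × (∀ k, Fin (d k))) ℂ}
    (h : ρ ∈ convexHull ℝ (auxP d₁ n d)) : SeparableMulti ρ := by
  obtain ⟨ι, _, w, z, hw, hw1, hz, hx⟩ := mem_convexHull_iff_exists_fintype.1 h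
  choose q hq hqz using hz
  let e := (Fintype.equivFin ι).symm
  refine ⟨Fintype.card ι, w ∘ e, fun t => (q (e t)).1, fun t => (q (e t)).2, fun t => hw _,
    ?_, fun t => ⟨auxR_psd (hq _).1, (hq _).1.2.2⟩,
    fun t k => ⟨auxR_psd ((hq _).2 k trivial), ((hq _).2 k trivial).2.2⟩, ?_⟩
  · rw [← hw1]; exact e.sum_comp w
  · rw [← hx, ← e.sum_comp]
    refine Finset.sum_congr rfl fun t _ => ?_
    rw [← hqz]
    ext x y
    simp

theorem aux_trace_prod {n : ℕ} (d : Fin n → ℕ) (p : ∀ k, Matrix (Fin (d k)) (Fin (d k)) ℂ) :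
    (productMatrix d p).trace = ∏ k, (p k).trace := by
  simp only [Matrix.trace, Finset.prod_univ_sum, Fintype.piFinset_univ]
  rfl

theorem aux_herm_prod {n : ℕ} (d : Fin n → ℕ) (p : ∀ k, Matrix (Fin (d k)) (Fin (d k)) ℂ) :
    (productMatrix d p)ᴴ = productMatrix d fun k => (p k)ᴴ := by
  ext x y
  simp [productMatrix]

theorem aux_witness {d₁ n : ℕ} {d : Fin n → ℕ}
    {ρ : Matrix (Fin d₁ × (∀ k, Fin (d k))) (Fin d₁ × (∀ k, Fin (d k))) ℂ}
    (hρ : ρ.PosSemidef) (htr : ρ.trace = 1) (h : ρ ∉ convexHull ℝ (auxP d₁ n d)) :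
    ∃ F : Matrix (Fin d₁ × (∀ k, Fin (d k))) (Fin d₁ × (∀ k, Fin (d k))) ℂ →ₗ[ℂ] ℂ,
      (∀ a, F aᴴ = star (F a)) ∧ (F ρ).re < 0 ∧ ∀ a ∈ auxP d₁ n d, 0 ≤ (F a).re := by
  let _ : NormedAddCommGroup (Matrix (Fin d₁ × (∀ k, Fin (d k))) (Fin d₁ × (∀ k, Fin (d k))) ℂ) :=
    Matrix.normedAddCommGroup
  let _ : NormedSpace ℝ (Matrix (Fin d₁ × (∀ k, Fin (d k))) (Fin d₁ × (∀ k, Fin (d k))) ℂ) :=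
    Matrix.normedSpace
  let _ : NormedSpace ℂ (Matrix (Fin d₁ × (∀ k, Fin (d k))) (Fin d₁ × (∀ k, Fin (d k))) ℂ) :=
    Matrix.normedSpace
  obtain ⟨G, u, hG1, hG2⟩ := RCLike.geometric_hahn_banach_point_closed (𝕜 := ℂ)
    (convex_convexHull ℝ (auxP d₁ n d))
    (aux_isCompact_convexHull (auxP_compact d₁ n d)).isClosed h
  let F : Matrix (Fin d₁ × (∀ k, Fin (d k))) (Fin d₁ × (∀ k, Fin (d k))) ℂ →ₗ[ℂ] ℂ :=
    { toFun := fun a => (G a + star (G aᴴ)) / 2 - u * a.trace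
      map_add' := fun a b => by
        simp only [conjTranspose_add, map_add, star_add, trace_add]; ring
      map_smul' := fun c a => by
        simp only [conjTranspose_smul, map_smul, trace_smul, smul_eq_mul, star_mul', star_star,
          RingHom.id_apply]; ring }
  have hF : ∀ a, F a = (G a + star (G aᴴ)) / 2 - u * a.trace := fun a => rfl
  have hFre : ∀ a, a.IsHermitian → a.trace = 1 → (F a).re = (G a).re - u := by
    intro a ha hat
    rw [hF, ha.eq, hat]
    simp
  refine ⟨F, fun a => ?_, ?_, ?_⟩
  · rw [hF, hF, conjTranspose_conjTranspose, trace_conjTranspose]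
    simp
    ring
  · rw [hFre ρ hρ.1 htr]
    exact sub_neg.2 hG1
  · intro a ha
    have h2 := hG2 a (subset_convexHull ℝ _ ha)
    obtain ⟨q, hq, rfl⟩ := ha
    rw [hFre]
    · exact (sub_pos.2 h2).le
    · change (_ ⊗ₖ _)ᴴ = _
      rw [conjTranspose_kronecker, aux_herm_prod, hq.1.1.eq]
      congr 2
      funext k
      exact (hq.2 k trivial).1.eq
    · rw [trace_kronecker, aux_trace_prod, hq.1.2.2, Finset.prod_eq_one]
      · simp
      · intro k _
        exact (hq.2 k trivial).2.2

theorem aux_phi_of_witness {d₁ n : ℕ} {d : Fin n → ℕ}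
    (F : Matrix (Fin d₁ × (∀ k, Fin (d k))) (Fin d₁ × (∀ k, Fin (d k))) ℂ →ₗ[ℂ] ℂ)
    (hF : ∀ a, F aᴴ = star (F a)) (hpos : ∀ a ∈ auxP d₁ n d, 0 ≤ (F a).re) :
    ∃ φ : Matrix (∀ k, Fin (d k)) (∀ k, Fin (d k)) ℂ →ₗ[ℂ] Matrix (Fin d₁) (Fin d₁) ℂ,
      (∀ a i j, φ a i j = F (Matrix.single i j 1 ⊗ₖ a)) ∧ (∀ a, φ aᴴ = (φ a)ᴴ) ∧
      ∀ p : ∀ k, Matrix (Fin (d k)) (Fin (d k)) ℂ,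
          (∀ k, (p k).IsHermitian ∧ p k * p k = p k ∧ (p k).trace = 1) →
          (φ (productMatrix d p)).PosSemidef := by
  let φ : Matrix (∀ k, Fin (d k)) (∀ k, Fin (d k)) ℂ →ₗ[ℂ] Matrix (Fin d₁) (Fin d₁) ℂ :=
    { toFun := fun a => Matrix.of fun i j => F (Matrix.single i j 1 ⊗ₖ a)
      map_add' := fun a b => by ext i j; simp [Matrix.kronecker_add]
      map_smul' := fun c a => by ext i j; simp [Matrix.kronecker_smul] }
  have hφ : ∀ a i j, φ a i j = F (Matrix.single i j 1 ⊗ₖ a) := fun _ _ _ => rfl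
  have hφH : ∀ a, φ aᴴ = (φ a)ᴴ := by
    intro a
    ext i j
    rw [conjTranspose_apply, hφ, hφ, ← hF, conjTranspose_kronecker, conjTranspose_single, star_one]
  refine ⟨φ, hφ, hφH, fun p hp => ?_⟩
  have hherm : (productMatrix d p)ᴴ = productMatrix d p := by
    rw [aux_herm_prod]; congr 1; funext k; exact (hp k).1.eq
  refine PosSemidef.of_dotProduct_mulVec_nonneg ?_ fun v => ?_
  · change (φ _)ᴴ = _
    rw [← hφH, hherm]
  have key : star v ⬝ᵥ (φ (productMatrix d p) *ᵥ v) =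
      F (vecMulVec (star v) v ⊗ₖ productMatrix d p) := by
    rw [aux_kron]
    simp only [dotProduct, mulVec, Finset.mul_sum, hφ, vecMulVec_apply]
    exact Finset.sum_congr rfl fun i _ => Finset.sum_congr rfl fun j _ => by ring
  have hreal : star (F (vecMulVec (star v) v ⊗ₖ productMatrix d p)) =
      F (vecMulVec (star v) v ⊗ₖ productMatrix d p) := by
    rw [← hF, conjTranspose_kronecker, hherm, (posSemidef_vecMulVec_star_self v).1.eq]
  rw [key, Complex.nonneg_iff]
  refine ⟨?_, (Complex.conj_eq_iff_im.1 hreal).symm⟩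
  by_cases hv : v = 0
  · subst hv
    have : vecMulVec (star (0 : Fin d₁ → ℂ)) (0 : Fin d₁ → ℂ) = 0 := by ext; simp [vecMulVec_apply]
    simp [this]
  set N : ℝ := ∑ i, ‖v i‖ ^ 2 with hN
  have hNpos : 0 < N := by
    obtain ⟨i, hi⟩ := Function.ne_iff.1 hv
    refine Finset.sum_pos' (fun _ _ => by positivity) ⟨i, Finset.mem_univ i, ?_⟩
    have := norm_pos_iff.2 hi
    positivity
  have hNC : star v ⬝ᵥ v = (N : ℂ) := by
    simp [dotProduct, hN, ← Complex.conj_mul']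
  set r : ℝ := (Real.sqrt N)⁻¹ with hr
  have hrN : r * r * N = 1 := by
    rw [hr, ← mul_inv, Real.mul_self_sqrt hNpos.le]; field_simp
  have hmem := auxR_vec (star ((r : ℂ) • v)) (by
    rw [star_star, dotProduct_comm, star_smul, smul_dotProduct, dotProduct_smul, hNC]
    simp only [smul_eq_mul, Complex.star_def, Complex.conj_ofReal]
    rw [← mul_assoc]
    exact_mod_cast hrN)
  have h0 := hpos _ ⟨(_, p), ⟨hmem, fun k _ => hp k⟩, rfl⟩
  have hw : vecMulVec (star v) v =
      (N : ℂ) • vecMulVec (star ((r : ℂ) • v)) (star (star ((r : ℂ) • v))) := by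
    ext i j
    have hrN' : (r : ℂ) * r * N = 1 := by exact_mod_cast hrN
    simp only [vecMulVec_apply, Matrix.smul_apply, star_star, Pi.star_apply, Pi.smul_apply,
      smul_eq_mul, star_mul', Complex.star_def, Complex.conj_ofReal]
    linear_combination (-(starRingEnd ℂ (v i) * v j)) * hrN'
  rw [hw, Matrix.smul_kronecker, map_smul, smul_eq_mul, Complex.re_ofReal_mul]
  exact mul_nonneg hNpos.le h0

/-- An `(n+1)`-partite state `ρ` is separable iff `(id ⊗ φ) ρ ≥ 0` for every
Hermiticity-preserving linear map `φ` that is positive on product projections. -/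
theorem multipartite_separable_iff (d₁ n : ℕ) (d : Fin n → ℕ)
    (ρ : Matrix (Fin d₁ × (∀ k, Fin (d k))) (Fin d₁ × (∀ k, Fin (d k))) ℂ)
    (hρ : ρ.PosSemidef) (htr : ρ.trace = 1) :
    SeparableMulti ρ ↔
      ∀ φ : Matrix (∀ k, Fin (d k)) (∀ k, Fin (d k)) ℂ →ₗ[ℂ]
          Matrix (Fin d₁) (Fin d₁) ℂ,
        (∀ a, φ aᴴ = (φ a)ᴴ) →
        (∀ p : ∀ k, Matrix (Fin (d k)) (Fin (d k)) ℂ,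
          (∀ k, (p k).IsHermitian ∧ p k * p k = p k ∧ (p k).trace = 1) →
          (φ (productMatrix d p)).PosSemidef) →
        (idTensorMap φ ρ).PosSemidef := by
  constructor
  · rintro ⟨m, c, σ₁, σ, hc, -, hσ₁, hσ, rfl⟩ φ - hφ
    rw [aux_idTensor]
    refine posSemidef_sum _ fun t _ => ?_
    refine PosSemidef.smul ?_ (by exact_mod_cast hc t)
    exact (hσ₁ t).1.kronecker (aux_phi_psd φ hφ _ fun k => (hσ t k).1)
  · intro H
    by_contra hsep
    obtain ⟨F, hF, hneg, hpos⟩ := aux_witness hρ htr fun h => hsep (aux_sep_of_mem h)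
    obtain ⟨φ, hφ, hφH, hφp⟩ := aux_phi_of_witness F hF hpos
    have h1 := (H φ hφH hφp).dotProduct_mulVec_nonneg
      (fun p : Fin d₁ × Fin d₁ => if p.1 = p.2 then (1 : ℂ) else 0)
    have h2 : star (fun p : Fin d₁ × Fin d₁ => if p.1 = p.2 then (1 : ℂ) else 0) ⬝ᵥ
        (idTensorMap φ ρ *ᵥ fun p : Fin d₁ × Fin d₁ => if p.1 = p.2 then (1 : ℂ) else 0) =
        F ρ := by
      rw [aux_block_s14 F ρ]
      simp [dotProduct, mulVec, Fintype.sum_prod_type, idTensorMap, hφ, apply_ite star]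
    rw [h2] at h1
    exact absurd (Complex.nonneg_iff.1 h1).1 (not_le.2 hneg)
end
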